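/- arXiv:2508.04320 — 3 statements merged into one kernel-verified Lean document; each statement's English description precedes it below -/
import Mathlib

section
/- Let J = Z. Suppose the diagonal system x(n+1) = diag(A11(n), A22(n)) x(n) admits an exponential dichotomy on Z and sup_{n∈Z} ‖A12(n)‖ < +∞. Then the triangular system x(n+1) = (A11(n) A12(n); 0 A22(n)) x(n) admits an exponential dichotomy on Z. -/
open Real ContinuousLinearMap

noncomputable section

universe u

variable {X : Type u} [NormedAddCommGroup X] [NormedSpace ℝ X]

/-- The cocycle associated with the system `x(n+1) = A(n) x(n)`, as a function of the
number of steps: `cocycleAux A n k = A(n+k-1) ∘ ⋯ ∘ A(n)`. -/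
def cocycleAux (A : ℤ → X →L[ℝ] X) (n : ℤ) : ℕ → (X →L[ℝ] X)
  | 0 => ContinuousLinearMap.id ℝ X
  | k + 1 => (A (n + k)).comp (cocycleAux A n k)

/-- The cocycle `Φ(m, n) = A(m-1) ⋯ A(n)` for `m > n`, and `Φ(n, n) = Id`. -/
def Phi (A : ℤ → X →L[ℝ] X) (m n : ℤ) : X →L[ℝ] X :=
  cocycleAux A n (m - n).toNat

/-- The system `x(n+1) = A(n) x(n)`, `n ∈ J'`, admits an exponential dichotomy on `J`
with respect to the family of (bounded) projections `P(n)`, `n ∈ J`: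
there are constants `K, α > 0` such that
(i) `P(n)` are projections, `A(n) P(n) = P(n+1) A(n)` for `n ∈ J'`, and `A(n)` maps
`ker P(n)` bijectively onto `ker P(n+1)` for `n ∈ J'`;
(ii) `‖Φ(m,n) P(n)‖ ≤ K e^{-α (m-n)}` for `m ≥ n` in `J`;
(iii) `‖Φ(m,n) (Id - P(n))‖ ≤ K e^{-α (n-m)}` for `m ≤ n` in `J`, where
`Φ(m,n) : ker P(n) → ker P(m)` denotes the inverse of `Φ(n,m)` restricted to `ker P(m)`;
the latter is phrased as: whenever `x ∈ ker P(m)` and `Φ(n,m) x = (Id - P(n)) y`,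
then `‖x‖ ≤ K e^{-α (n-m)} ‖y‖`. -/
def IsExpDichotomy (J J' : Set ℤ) (A P : ℤ → X →L[ℝ] X) : Prop :=
  ∃ K α : ℝ, 0 < K ∧ 0 < α ∧
    (∀ n ∈ J, (P n).comp (P n) = P n) ∧
    (∀ n ∈ J', (A n).comp (P n) = (P (n + 1)).comp (A n)) ∧
    (∀ n ∈ J', Set.BijOn (A n) {x : X | P n x = 0} {x : X | P (n + 1) x = 0}) ∧
    (∀ m n : ℤ, m ∈ J → n ∈ J → n ≤ m →
      ‖(Phi A m n).comp (P n)‖ ≤ K * Real.exp (-α * ((m : ℝ) - (n : ℝ)))) ∧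
    (∀ m n : ℤ, m ∈ J → n ∈ J → m ≤ n → ∀ x y : X,
      P m x = 0 → Phi A n m x = y - P n y →
      ‖x‖ ≤ K * Real.exp (-α * ((n : ℝ) - (m : ℝ))) * ‖y‖)

/-- The system `x(n+1) = A(n) x(n)`, `n ∈ J'`, admits an exponential dichotomy on `J`. -/
def ExpDichotomy (J J' : Set ℤ) (A : ℤ → X →L[ℝ] X) : Prop :=
  ∃ P : ℤ → X →L[ℝ] X, IsExpDichotomy J J' A P

/-- A subspace (given as a set) `S` of `X` is complemented: there is a closed subspace `Z`
of `X` with `X = S ⊕ Z`. -/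
def IsComplementedSubspace (S : Set X) : Prop :=
  ∃ Z : Submodule ℝ X, IsClosed (Z : Set X) ∧
    (∀ v ∈ S, v ∈ Z → v = (0 : X)) ∧ ∀ v : X, ∃ s ∈ S, ∃ z ∈ Z, v = s + z

/-- The subspace `S = {v : sup_{n ∈ ℤ⁺} ‖Φ(n,0) v‖ < ∞}` of initial conditions of bounded
forward solutions. -/
def Sset (A : ℤ → X →L[ℝ] X) : Set X :=
  {v : X | ∃ C : ℝ, ∀ n : ℤ, 0 ≤ n → ‖Phi A n 0 v‖ ≤ C}

/-- The subspace `U(m)` of all `v` for which there is a bounded sequence `(x(n))_{n ≤ m}`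
with `x(m) = v` and `x(n) = A(n-1) x(n-1)` for `n ≤ m`. -/
def Uset (A : ℤ → X →L[ℝ] X) (m : ℤ) : Set X :=
  {v : X | ∃ x : ℤ → X, x m = v ∧ (∃ C : ℝ, ∀ n : ℤ, n ≤ m → ‖x n‖ ≤ C) ∧
    ∀ n : ℤ, n ≤ m → x n = A (n - 1) (x (n - 1))}

variable {X1 : Type u} {X2 : Type u} [NormedAddCommGroup X1] [NormedSpace ℝ X1]
  [NormedAddCommGroup X2] [NormedSpace ℝ X2]

/-- The triangular system operator `(x1, x2) ↦ (A11(n) x1 + A12(n) x2, A22(n) x2)`. -/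
def triangular (A11 : ℤ → X1 →L[ℝ] X1) (A12 : ℤ → X2 →L[ℝ] X1)
    (A22 : ℤ → X2 →L[ℝ] X2) (n : ℤ) : (X1 × X2) →L[ℝ] X1 × X2 :=
  (((A11 n).comp (fst ℝ X1 X2)) + ((A12 n).comp (snd ℝ X1 X2))).prod
    ((A22 n).comp (snd ℝ X1 X2))

/-- The diagonal system operator `(x1, x2) ↦ (A11(n) x1, A22(n) x2)`. -/
def diagonal (A11 : ℤ → X1 →L[ℝ] X1) (A22 : ℤ → X2 →L[ℝ] X2) (n : ℤ) :
    (X1 × X2) →L[ℝ] X1 × X2 :=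
  (A11 n).prodMap (A22 n)

section Cocycle

variable (A : ℤ → X →L[ℝ] X)

lemma Phi_self (n : ℤ) : Phi A n n = ContinuousLinearMap.id ℝ X := by
  simp [Phi, cocycleAux]

lemma Phi_succ {m n : ℤ} (h : n ≤ m) : Phi A (m + 1) n = (A m).comp (Phi A m n) := by
  have h1 : (m + 1 - n).toNat = (m - n).toNat + 1 := by omega
  have h2 : n + ((m - n).toNat : ℤ) = m := by omega
  rw [Phi, Phi, h1, cocycleAux, h2]

lemma Phi_succ_self (n : ℤ) : Phi A (n + 1) n = A n := by
  rw [Phi_succ A le_rfl, Phi_self, ContinuousLinearMap.comp_id]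

lemma Phi_eq_comp_right {m n : ℤ} (h : n + 1 ≤ m) :
    Phi A m n = (Phi A m (n + 1)).comp (A n) := by
  induction m, h using Int.leInduction with
  | base => rw [Phi_succ_self, Phi_self, ContinuousLinearMap.id_comp]
  | succ m h ih => rw [Phi_succ A (by omega), Phi_succ A h, ih, ContinuousLinearMap.comp_assoc]

end Cocycle

/-- `G` is an exponentially decaying Green's function of `x(n+1) = A(n) x(n)` on `ℤ`. -/
structure IsGreenFunction (A : ℤ → X →L[ℝ] X) (G : ℤ → ℤ → X →L[ℝ] X) (K α : ℝ) : Prop where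
  rate_pos : 0 < α
  succ_left : ∀ m n x, G (m + 1) n x = A m (G m n x) + if m + 1 = n then x else 0
  succ_right : ∀ m n x, G m n x = G m (n + 1) (A n x) + if m = n then x else 0
  norm_le : ∀ m n, ‖G m n‖ ≤ K * Real.exp (-α * |(m : ℝ) - n|)

namespace IsGreenFunction

variable {A : ℤ → X →L[ℝ] X} {G : ℤ → ℤ → X →L[ℝ] X} {K α : ℝ}

lemma const_nonneg (h : IsGreenFunction A G K α) : 0 ≤ K := by
  simpa using (norm_nonneg _).trans (h.norm_le 0 0)

lemma norm_le_const (h : IsGreenFunction A G K α) (m n : ℤ) : ‖G m n‖ ≤ K := by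
  refine (h.norm_le m n).trans (mul_le_of_le_one_right h.const_nonneg ?_)
  rw [Real.exp_le_one_iff]
  nlinarith [h.rate_pos, abs_nonneg ((m : ℝ) - n)]

lemma norm_apply_le (h : IsGreenFunction A G K α) (m n : ℤ) (x : X) :
    ‖G m n x‖ ≤ K * Real.exp (-α * |(m : ℝ) - n|) * ‖x‖ :=
  (G m n).le_of_opNorm_le (h.norm_le m n) x

lemma eq_Phi_comp (h : IsGreenFunction A G K α) {m n : ℤ} (hmn : n ≤ m) :
    G m n = (Phi A m n).comp (G n n) := by
  induction m, hmn using Int.leInduction with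
  | base => rw [Phi_self, ContinuousLinearMap.id_comp]
  | succ m hm ih =>
    ext x
    rw [h.succ_left, if_neg (by omega), add_zero, Phi_succ A hm, ih]
    rfl

lemma comm (h : IsGreenFunction A G K α) (n : ℤ) (x : X) :
    A n (G n n x) = G (n + 1) (n + 1) (A n x) := by
  have h1 := h.succ_left n n x
  have h2 := h.succ_right (n + 1) n x
  rw [if_neg (by omega), add_zero] at h1 h2
  rw [← h1, h2]

lemma diag_apply_of_lt_aux (h : IsGreenFunction A G K α) {n b : ℤ} (hb : n < b) (x : X) (k : ℕ) :
    G n n (G n b x) = G n (n - k) (G (n - k) b x) := by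
  induction k with
  | zero => simp
  | succ k ih =>
    have e : n - ((k + 1 : ℕ) : ℤ) + 1 = n - k := by push_cast; ring
    have h1 := h.succ_left (n - ((k + 1 : ℕ) : ℤ)) b x
    rw [e, if_neg (by omega), add_zero] at h1
    have h2 := h.succ_right n (n - ((k + 1 : ℕ) : ℤ)) (G (n - ((k + 1 : ℕ) : ℤ)) b x)
    rw [e, if_neg (by push_cast; omega), add_zero] at h2
    rw [ih, h1, h2]

lemma diag_apply_of_lt (h : IsGreenFunction A G K α) {n b : ℤ} (hb : n < b) (x : X) :
    G n n (G n b x) = 0 := by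
  have lim : Filter.Tendsto (fun k : ℕ => K * Real.exp (-α) ^ k * (K * ‖x‖)) Filter.atTop
      (nhds 0) := by
    have := ((tendsto_pow_atTop_nhds_zero_of_lt_one (Real.exp_pos (-α)).le
      (by simpa using h.rate_pos)).const_mul K).mul_const (K * ‖x‖)
    simpa using this
  rw [← norm_le_zero_iff]
  refine ge_of_tendsto' lim fun k => ?_
  rw [h.diag_apply_of_lt_aux hb x k]
  refine (h.norm_apply_le _ _ _).trans ?_
  have e : -α * |(n : ℝ) - ((n - k : ℤ) : ℝ)| = k * (-α) := by
    push_cast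
    rw [sub_sub_cancel, abs_of_nonneg (Nat.cast_nonneg k)]
    ring
  rw [e, Real.exp_nat_mul]
  have := h.const_nonneg
  gcongr
  exact (G (n - k) b).le_of_opNorm_le (h.norm_le_const _ _) x

lemma diag_idem (h : IsGreenFunction A G K α) (n : ℤ) (x : X) : G n n (G n n x) = G n n x := by
  obtain ⟨m, rfl⟩ : ∃ m, n = m + 1 := ⟨n - 1, by ring⟩
  have h1 := h.succ_left m (m + 1) x
  rw [if_pos rfl] at h1
  conv_lhs => rw [h1, map_add, ← h.comm, h.diag_apply_of_lt (by omega), map_zero, zero_add]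

lemma eq_neg_apply_of_mem_ker (h : IsGreenFunction A G K α) {m n : ℤ} (hmn : m + 1 ≤ n) {x : X}
    (hx : G m m x = 0) : x = -G m n (Phi A n m x) := by
  induction n, hmn using Int.leInduction with
  | base =>
    have h1 := h.succ_right m m x
    rw [if_pos rfl, hx] at h1
    rw [Phi_succ_self]
    exact eq_neg_of_add_eq_zero_right h1.symm
  | succ n hn ih =>
    have h1 := h.succ_right m n (Phi A n m x)
    rw [if_neg (by omega), add_zero] at h1
    rw [Phi_succ A (by omega), ContinuousLinearMap.comp_apply, ← h1]
    exact ih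

lemma bijOn_ker (h : IsGreenFunction A G K α) (n : ℤ) :
    Set.BijOn (A n) {x : X | G n n x = 0} {x : X | G (n + 1) (n + 1) x = 0} := by
  refine ⟨fun x hx => ?_, fun x hx y hy hxy => ?_, fun y hy => ⟨-G n (n + 1) y, ?_, ?_⟩⟩
  · simp only [Set.mem_ofPred_eq] at hx ⊢
    rw [← h.comm, hx, map_zero]
  · have h1 := h.eq_neg_apply_of_mem_ker le_rfl hx
    have h2 := h.eq_neg_apply_of_mem_ker le_rfl hy
    rw [Phi_succ_self] at h1 h2
    rw [h1, h2, hxy]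
  · simp [h.diag_apply_of_lt (lt_add_one n)]
  · have h1 := h.succ_left n (n + 1) y
    rw [if_pos rfl, show G (n + 1) (n + 1) y = 0 from hy] at h1
    rw [map_neg]
    exact (eq_neg_of_add_eq_zero_right h1.symm).symm

lemma norm_le_of_mem_ker (h : IsGreenFunction A G K α) {m n : ℤ} (hmn : m ≤ n) {x y : X}
    (hx : G m m x = 0) (hy : Phi A n m x = y - G n n y) :
    ‖x‖ ≤ (K + 1) ^ 2 * Real.exp (-α * ((n : ℝ) - m)) * ‖y‖ := by
  have hK := h.const_nonneg
  have hQ : ‖y - G n n y‖ ≤ (K + 1) * ‖y‖ := by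
    have := (G n n).le_of_opNorm_le (h.norm_le_const n n) y
    linarith [norm_sub_le y (G n n y)]
  rcases hmn.eq_or_lt with rfl | hlt
  · rw [Phi_self, ContinuousLinearMap.id_apply] at hy
    rw [hy, sub_self, mul_zero, Real.exp_zero, mul_one]
    nlinarith [mul_nonneg hK (norm_nonneg y), mul_nonneg (mul_nonneg hK hK) (norm_nonneg y)]
  · have hG := h.norm_apply_le m n (y - G n n y)
    have e : |(m : ℝ) - n| = n - m := by
      rw [abs_sub_comm, abs_of_nonneg (by exact_mod_cast (sub_nonneg.2 hmn))]
    rw [h.eq_neg_apply_of_mem_ker hlt hx, norm_neg, hy]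
    rw [e] at hG
    calc ‖G m n (y - G n n y)‖
        ≤ K * Real.exp (-α * ((n : ℝ) - m)) * ‖y - G n n y‖ := hG
      _ ≤ (K + 1) * Real.exp (-α * ((n : ℝ) - m)) * ((K + 1) * ‖y‖) := by gcongr; linarith
      _ = (K + 1) ^ 2 * Real.exp (-α * ((n : ℝ) - m)) * ‖y‖ := by ring

theorem expDichotomy (h : IsGreenFunction A G K α) :
    ExpDichotomy (Set.univ : Set ℤ) Set.univ A := by
  have hK := h.const_nonneg
  refine ⟨fun n => G n n, (K + 1) ^ 2, α, by positivity, h.rate_pos, fun n _ => ?_, fun n _ => ?_,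
    fun n _ => h.bijOn_ker n, fun m n _ _ hmn => ?_,
    fun m n _ _ hmn x y hx hy => h.norm_le_of_mem_ker hmn hx hy⟩
  · ext x
    exact h.diag_idem n x
  · ext x
    exact h.comm n x
  · rw [← h.eq_Phi_comp hmn]
    refine (h.norm_le m n).trans ?_
    rw [abs_of_nonneg (by exact_mod_cast (sub_nonneg.2 hmn))]
    gcongr
    nlinarith

end IsGreenFunction

section Dichotomy

variable {A P : ℤ → X →L[ℝ] X}

lemma surjOn_Phi_ker
    (hbij : ∀ n, Set.BijOn (A n) {x : X | P n x = 0} {x : X | P (n + 1) x = 0})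
    {m n : ℤ} (hmn : m ≤ n) :
    Set.SurjOn (Phi A n m) {x : X | P m x = 0} {x : X | P n x = 0} := by
  induction n, hmn using Int.leInduction with
  | base => rw [Phi_self]; exact Set.surjOn_id _
  | succ n hn ih => rw [Phi_succ A hn]; exact (hbij n).surjOn.comp ih

/-- The Green's function of a system with an exponential dichotomy on `ℤ`. -/
theorem ExpDichotomy.exists_isGreenFunction (h : ExpDichotomy (Set.univ : Set ℤ) Set.univ A) :
    ∃ G K α, IsGreenFunction A G K α := by
  obtain ⟨P, K, α, hK, hα, hidem, hcomm, hbij, hst, hun⟩ := h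
  replace hidem : ∀ n x, P n (P n x) = P n x := fun n x =>
    DFunLike.congr_fun (hidem n trivial) x
  replace hcomm : ∀ n x, A n (P n x) = P (n + 1) (A n x) := fun n x =>
    DFunLike.congr_fun (hcomm n trivial) x
  replace hbij := fun n => hbij n trivial
  replace hst := fun m n => hst m n trivial trivial
  replace hun := fun m n => hun m n trivial trivial
  have uniq : ∀ m n, m ≤ n → ∀ x x', P m x = 0 → P m x' = 0 → Phi A n m x = Phi A n m x' →
      x = x' := fun m n hmn x x' hx hx' he => by
    have := hun m n hmn (x - x') 0 (by simp [hx, hx']) (by simp [he])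
    rwa [norm_zero, mul_zero, norm_le_zero_iff, sub_eq_zero] at this
  have exH : ∀ m n, ∃ H : X →L[ℝ] X, m ≤ n →
      (∀ y, P m (H y) = 0 ∧ Phi A n m (H y) = y - P n y) ∧
      ‖H‖ ≤ K * Real.exp (-α * ((n : ℝ) - m)) := fun m n => by
    by_cases hmn : m ≤ n
    · have hex : ∀ y, ∃ x, P m x = 0 ∧ Phi A n m x = y - P n y := fun y =>
        surjOn_Phi_ker hbij hmn (by simp [hidem] : y - P n y ∈ {x : X | P n x = 0})
      choose f hf0 hf using hex
      let L : X →ₗ[ℝ] X :=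
        { toFun := f
          map_add' := fun x y => uniq m n hmn _ _ (hf0 _) (by simp [hf0]) (by
            simp only [map_add, hf]; abel)
          map_smul' := fun c x => uniq m n hmn _ _ (hf0 _) (by simp [hf0]) (by
            simp [hf, smul_sub]) }
      refine ⟨L.mkContinuous _ fun y => hun m n hmn (f y) y (hf0 y) (hf y), fun _ =>
        ⟨fun y => ⟨hf0 y, hf y⟩, L.mkContinuous_norm_le (by positivity) _⟩⟩
    · exact ⟨0, fun h => absurd h hmn⟩
  choose H hH using exH
  have H0 : ∀ m n, m ≤ n → ∀ y, P m (H m n y) = 0 := fun m n hmn y => ((hH m n hmn).1 y).1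
  have HPhi : ∀ m n, m ≤ n → ∀ y, Phi A n m (H m n y) = y - P n y :=
    fun m n hmn y => ((hH m n hmn).1 y).2
  refine ⟨fun m n => if n ≤ m then (Phi A m n).comp (P n) else -H m n, K, α, hα, ?_, ?_, ?_⟩
  · intro m n x
    rcases lt_trichotomy (m + 1) n with hlt | rfl | hgt
    · rw [if_neg (by omega), if_neg (by omega), if_neg (by omega), add_zero]
      simp only [_root_.neg_apply, map_neg, neg_inj]
      refine uniq (m + 1) n hlt.le _ _ (H0 _ _ hlt.le _) ?_ ?_
      · rw [← hcomm, H0 m n (by omega), map_zero]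
      · rw [HPhi _ _ hlt.le, ← ContinuousLinearMap.comp_apply, ← Phi_eq_comp_right A hlt.le,
          HPhi _ _ (by omega)]
    · have h1 := HPhi m (m + 1) (by omega) x
      rw [Phi_succ_self] at h1
      simp [h1, Phi_self]
    · rw [if_pos (by omega), if_pos (by omega), if_neg (by omega), add_zero,
        Phi_succ A (by omega)]
      rfl
  · intro m n x
    rcases lt_trichotomy m n with hlt | rfl | hgt
    · rw [if_neg (by omega), if_neg (by omega), if_neg (by omega), add_zero]
      simp only [_root_.neg_apply, neg_inj]
      refine uniq m (n + 1) (by omega) _ _ (H0 _ _ hlt.le _) (H0 _ _ (by omega) _) ?_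
      rw [HPhi _ _ (by omega), Phi_succ A hlt.le, ContinuousLinearMap.comp_apply,
        HPhi _ _ hlt.le, map_sub, hcomm]
    · have h1 : x - P m x = H m (m + 1) (A m x) := by
        refine uniq m (m + 1) (by omega) _ _ (by simp [hidem]) (H0 _ _ (by omega) _) ?_
        rw [HPhi _ _ (by omega), Phi_succ_self, map_sub, hcomm]
      simp [← h1, Phi_self]
    · rw [if_pos (by omega), if_pos (by omega), if_neg (by omega), add_zero,
        ContinuousLinearMap.comp_apply, ContinuousLinearMap.comp_apply, ← hcomm,
        Phi_eq_comp_right A (by omega)]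
      rfl
  · intro m n
    split_ifs with hmn
    · rw [abs_of_nonneg (by exact_mod_cast (sub_nonneg.2 hmn))]
      exact hst m n hmn
    · rw [norm_neg, abs_sub_comm,
        abs_of_nonneg (by exact_mod_cast (sub_nonneg.2 (not_le.1 hmn).le))]
      exact (hH m n (by omega)).2

end Dichotomy

section Blocks

variable {A11 : ℤ → X1 →L[ℝ] X1} {A22 : ℤ → X2 →L[ℝ] X2}
  {G : ℤ → ℤ → (X1 × X2) →L[ℝ] X1 × X2} {K α : ℝ}

lemma norm_fst_comp_inl_le (T : (X1 × X2) →L[ℝ] X1 × X2) :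
    ‖(fst ℝ X1 X2).comp (T.comp (inl ℝ X1 X2))‖ ≤ ‖T‖ :=
  ContinuousLinearMap.opNorm_le_bound _ (norm_nonneg _) fun x =>
    (_root_.norm_fst_le _).trans ((T.le_opNorm _).trans (by simp [Prod.norm_def]))

lemma norm_snd_comp_inr_le (T : (X1 × X2) →L[ℝ] X1 × X2) :
    ‖(snd ℝ X1 X2).comp (T.comp (inr ℝ X1 X2))‖ ≤ ‖T‖ :=
  ContinuousLinearMap.opNorm_le_bound _ (norm_nonneg _) fun x =>
    (_root_.norm_snd_le _).trans ((T.le_opNorm _).trans (by simp [Prod.norm_def]))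

lemma IsGreenFunction.fst_block (h : IsGreenFunction (diagonal A11 A22) G K α) :
    IsGreenFunction A11 (fun m n => (fst ℝ X1 X2).comp ((G m n).comp (inl ℝ X1 X2))) K α where
  rate_pos := h.rate_pos
  succ_left m n x := by
    have := congrArg Prod.fst (h.succ_left m n (x, 0))
    split_ifs at this ⊢ <;> simpa [diagonal] using this
  succ_right m n x := by
    have := congrArg Prod.fst (h.succ_right m n (x, 0))
    split_ifs at this ⊢ <;> simpa [diagonal] using this
  norm_le m n := (norm_fst_comp_inl_le _).trans (h.norm_le m n)

lemma IsGreenFunction.snd_block (h : IsGreenFunction (diagonal A11 A22) G K α) :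
    IsGreenFunction A22 (fun m n => (snd ℝ X1 X2).comp ((G m n).comp (inr ℝ X1 X2))) K α where
  rate_pos := h.rate_pos
  succ_left m n x := by
    have := congrArg Prod.snd (h.succ_left m n (0, x))
    split_ifs at this ⊢ <;> simpa [diagonal] using this
  succ_right m n x := by
    have := congrArg Prod.snd (h.succ_right m n (0, x))
    split_ifs at this ⊢ <;> simpa [diagonal] using this
  norm_le m n := (norm_snd_comp_inr_le _).trans (h.norm_le m n)

end Blocks

lemma summable_exp_neg_mul_abs_int {a : ℝ} (ha : 0 < a) :
    Summable fun k : ℤ => Real.exp (-a * |(k : ℝ)|) := by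
  have h : Summable fun k : ℕ => Real.exp (-a * k) := by
    simpa [mul_comm] using Real.summable_exp_nat_mul_iff.2 (neg_lt_zero.2 ha)
  exact Summable.of_nat_of_neg (by simpa using h) (by simpa using h)

section Triangular

variable {A11 : ℤ → X1 →L[ℝ] X1} {A12 : ℤ → X2 →L[ℝ] X1} {A22 : ℤ → X2 →L[ℝ] X2}
  {G1 : ℤ → ℤ → X1 →L[ℝ] X1} {G2 : ℤ → ℤ → X2 →L[ℝ] X2} {K α C : ℝ}

/-- The summands of the off-diagonal block of the Green's function of a triangular system. -/
def couplingTerm (A12 : ℤ → X2 →L[ℝ] X1) (G1 : ℤ → ℤ → X1 →L[ℝ] X1)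
    (G2 : ℤ → ℤ → X2 →L[ℝ] X2) (m n k : ℤ) : X2 →L[ℝ] X1 :=
  (G1 m (k + 1)).comp ((A12 k).comp (G2 k n))

lemma norm_couplingTerm_le (h1 : IsGreenFunction A11 G1 K α) (h2 : IsGreenFunction A22 G2 K α)
    (hC : ∀ n, ‖A12 n‖ ≤ C) (m n k : ℤ) :
    ‖couplingTerm A12 G1 G2 m n k‖ ≤
      K * C * K * Real.exp α * Real.exp (-(α / 2) * |(m : ℝ) - n|) *
        Real.exp (-(α / 2) * |((k - n : ℤ) : ℝ)|) := by
  have hK := h1.const_nonneg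
  have hα := h1.rate_pos
  have hC0 : 0 ≤ C := (norm_nonneg _).trans (hC 0)
  have hexp : Real.exp (-α * |(m : ℝ) - (k + 1 : ℤ)|) * Real.exp (-α * |(k : ℝ) - n|) ≤
      Real.exp α * Real.exp (-(α / 2) * |(m : ℝ) - n|) *
        Real.exp (-(α / 2) * |((k - n : ℤ) : ℝ)|) := by
    rw [← Real.exp_add, ← Real.exp_add, ← Real.exp_add, Real.exp_le_exp]
    push_cast
    have e1 : |(m : ℝ) - n| ≤ |(m : ℝ) - (k + 1)| + 1 + |(k : ℝ) - n| := by
      calc |(m : ℝ) - n| = |((m : ℝ) - (k + 1)) + 1 + (k - n)| := by congr 1; ring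
        _ ≤ |(m : ℝ) - (k + 1)| + |1| + |(k : ℝ) - n| := abs_add_three _ _ _
        _ = _ := by rw [abs_one]
    nlinarith [abs_nonneg ((m : ℝ) - (k + 1)), mul_le_mul_of_nonneg_left e1 hα.le,
      mul_nonneg hα.le (abs_nonneg ((m : ℝ) - (k + 1)))]
  calc ‖couplingTerm A12 G1 G2 m n k‖
      ≤ ‖G1 m (k + 1)‖ * (‖A12 k‖ * ‖G2 k n‖) :=
        (opNorm_comp_le _ _).trans
          (mul_le_mul_of_nonneg_left (opNorm_comp_le _ _) (norm_nonneg _))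
    _ ≤ (K * Real.exp (-α * |(m : ℝ) - (k + 1 : ℤ)|)) *
        (C * (K * Real.exp (-α * |(k : ℝ) - n|))) := by
        gcongr
        · exact h1.norm_le _ _
        · exact hC k
        · exact h2.norm_le _ _
    _ = K * C * K *
        (Real.exp (-α * |(m : ℝ) - (k + 1 : ℤ)|) * Real.exp (-α * |(k : ℝ) - n|)) := by ring
    _ ≤ K * C * K * (Real.exp α * Real.exp (-(α / 2) * |(m : ℝ) - n|) *
        Real.exp (-(α / 2) * |((k - n : ℤ) : ℝ)|)) := by gcongr
    _ = _ := by ring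

lemma hasSum_exp_neg_mul_abs_int_sub {a : ℝ} (ha : 0 < a) (n : ℤ) :
    HasSum (fun k : ℤ => Real.exp (-a * |((k - n : ℤ) : ℝ)|))
      (∑' k : ℤ, Real.exp (-a * |(k : ℝ)|)) :=
  (Equiv.subRight n).hasSum_iff.2 (summable_exp_neg_mul_abs_int ha).hasSum

/-- The off-diagonal block of the Green's function of a triangular system. -/
def coupling (A12 : ℤ → X2 →L[ℝ] X1) (G1 : ℤ → ℤ → X1 →L[ℝ] X1)
    (G2 : ℤ → ℤ → X2 →L[ℝ] X2) (m n : ℤ) : X2 →L[ℝ] X1 :=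
  ∑' k, couplingTerm A12 G1 G2 m n k

lemma norm_coupling_le (h1 : IsGreenFunction A11 G1 K α) (h2 : IsGreenFunction A22 G2 K α)
    (hC : ∀ n, ‖A12 n‖ ≤ C) (m n : ℤ) :
    ‖coupling A12 G1 G2 m n‖ ≤
      K * C * K * Real.exp α * Real.exp (-(α / 2) * |(m : ℝ) - n|) *
        ∑' k : ℤ, Real.exp (-(α / 2) * |(k : ℝ)|) :=
  tsum_of_norm_bounded ((hasSum_exp_neg_mul_abs_int_sub (half_pos h1.rate_pos) n).mul_left _)
    (norm_couplingTerm_le h1 h2 hC m n)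

variable [CompleteSpace X1]

lemma summable_couplingTerm (h1 : IsGreenFunction A11 G1 K α) (h2 : IsGreenFunction A22 G2 K α)
    (hC : ∀ n, ‖A12 n‖ ≤ C) (m n : ℤ) : Summable (couplingTerm A12 G1 G2 m n) :=
  Summable.of_norm_bounded
    ((hasSum_exp_neg_mul_abs_int_sub (half_pos h1.rate_pos) n).mul_left _).summable
    (norm_couplingTerm_le h1 h2 hC m n)

lemma hasSum_coupling_apply (h1 : IsGreenFunction A11 G1 K α) (h2 : IsGreenFunction A22 G2 K α)
    (hC : ∀ n, ‖A12 n‖ ≤ C) (m n : ℤ) (x : X2) :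
    HasSum (fun k => G1 m (k + 1) (A12 k (G2 k n x))) (coupling A12 G1 G2 m n x) :=
  (summable_couplingTerm h1 h2 hC m n).hasSum.mapL (ContinuousLinearMap.apply ℝ X1 x)

lemma coupling_succ_left (h1 : IsGreenFunction A11 G1 K α) (h2 : IsGreenFunction A22 G2 K α)
    (hC : ∀ n, ‖A12 n‖ ≤ C) (m n : ℤ) (x : X2) :
    coupling A12 G1 G2 (m + 1) n x = A11 m (coupling A12 G1 G2 m n x) + A12 m (G2 m n x) := by
  refine (hasSum_coupling_apply h1 h2 hC (m + 1) n x).unique ?_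
  convert ((hasSum_coupling_apply h1 h2 hC m n x).mapL (A11 m)).add
    (hasSum_ite_eq m (A12 m (G2 m n x))) using 2 with k
  rw [h1.succ_left]
  by_cases hk : k = m
  · subst hk; simp
  · rw [if_neg (by omega), if_neg hk]

lemma coupling_succ_right (h1 : IsGreenFunction A11 G1 K α) (h2 : IsGreenFunction A22 G2 K α)
    (hC : ∀ n, ‖A12 n‖ ≤ C) (m n : ℤ) (x : X2) :
    coupling A12 G1 G2 m n x =
      coupling A12 G1 G2 m (n + 1) (A22 n x) + G1 m (n + 1) (A12 n x) := by
  refine (hasSum_coupling_apply h1 h2 hC m n x).unique ?_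
  convert (hasSum_coupling_apply h1 h2 hC m (n + 1) (A22 n x)).add
    (hasSum_ite_eq n (G1 m (n + 1) (A12 n x))) using 2 with k
  rw [h2.succ_right]
  by_cases hk : k = n
  · subst hk; simp
  · simp [hk]

theorem exists_isGreenFunction_triangular (h1 : IsGreenFunction A11 G1 K α)
    (h2 : IsGreenFunction A22 G2 K α) (hC : ∀ n, ‖A12 n‖ ≤ C) :
    ∃ G K' α', IsGreenFunction (triangular A11 A12 A22) G K' α' := by
  set S : ℝ := ∑' k : ℤ, Real.exp (-(α / 2) * |(k : ℝ)|)
  have hα := h1.rate_pos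
  have hK := h1.const_nonneg
  have hC0 : 0 ≤ C := (norm_nonneg _).trans (hC 0)
  have hS : 0 ≤ S := tsum_nonneg fun _ => (Real.exp_pos _).le
  refine ⟨fun m n => ((G1 m n).comp (fst ℝ X1 X2) +
    (coupling A12 G1 G2 m n).comp (snd ℝ X1 X2)).prod ((G2 m n).comp (snd ℝ X1 X2)),
    K + K * C * K * Real.exp α * S, α / 2, half_pos hα, ?_, ?_, ?_⟩
  · rintro m n ⟨x, y⟩
    have e1 := h1.succ_left m n x
    have e2 := h2.succ_left m n y
    have e3 := coupling_succ_left h1 h2 hC m n y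
    split_ifs at e1 e2 ⊢ <;> ext <;> simp [triangular, e1, e2, e3] <;> abel
  · rintro m n ⟨x, y⟩
    have e1 := h1.succ_right m n x
    have e2 := h2.succ_right m n y
    have e3 := coupling_succ_right h1 h2 hC m n y
    split_ifs at e1 e2 ⊢ <;> ext <;> simp [triangular, e1, e2, e3] <;> abel
  · intro m n
    have hexp : Real.exp (-α * |(m : ℝ) - n|) ≤ Real.exp (-(α / 2) * |(m : ℝ) - n|) := by
      gcongr
      linarith
    have b1 : ‖G1 m n‖ ≤ K * Real.exp (-(α / 2) * |(m : ℝ) - n|) :=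
      (h1.norm_le m n).trans (by gcongr)
    have b2 : ‖G2 m n‖ ≤ K * Real.exp (-(α / 2) * |(m : ℝ) - n|) :=
      (h2.norm_le m n).trans (by gcongr)
    have b3 := norm_coupling_le h1 h2 hC m n
    refine ContinuousLinearMap.opNorm_le_bound _ (by positivity) fun z => ?_
    have c1 := (G1 m n).le_of_opNorm_le_of_le b1 (_root_.norm_fst_le z)
    have c2 := (G2 m n).le_of_opNorm_le_of_le b2 (_root_.norm_snd_le z)
    have c3 := (coupling A12 G1 G2 m n).le_of_opNorm_le_of_le b3 (_root_.norm_snd_le z)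
    refine max_le ((norm_add_le _ _).trans ((add_le_add c1 c3).trans_eq (by ring)))
      (c2.trans ?_)
    gcongr
    exact le_add_of_nonneg_right (by positivity)

end Triangular

theorem triangular_dichotomy_of_diagonal_Z {H1 : Type u} {H2 : Type u}
    [NormedAddCommGroup H1] [InnerProductSpace ℝ H1] [CompleteSpace H1]
    [NormedAddCommGroup H2] [InnerProductSpace ℝ H2] [CompleteSpace H2]
    (A11 : ℤ → H1 →L[ℝ] H1) (A12 : ℤ → H2 →L[ℝ] H1) (A22 : ℤ → H2 →L[ℝ] H2)
    (hdiag : ExpDichotomy (Set.univ : Set ℤ) Set.univ (diagonal A11 A22))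
    (hbdd : ∃ C : ℝ, ∀ n : ℤ, ‖A12 n‖ ≤ C) :
    ExpDichotomy (Set.univ : Set ℤ) Set.univ (triangular A11 A12 A22) := by
  obtain ⟨G, K, α, hG⟩ := hdiag.exists_isGreenFunction
  obtain ⟨C, hC⟩ := hbdd
  obtain ⟨_, _, _, hT⟩ := exists_isGreenFunction_triangular hG.fst_block hG.snd_block hC
  exact hT.expDichotomy

end
end

section
/- Let J = Z+. Suppose the diagonal system x(n+1) = diag(A11(n), A22(n)) x(n) admits an exponential dichotomy on Z+ and sup_{n∈Z+} ‖A12(n)‖ < +∞. Then the triangular system x(n+1) = (A11(n) A12(n); 0 A22(n)) x(n) admits an exponential dichotomy on Z+. -/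
open Real ContinuousLinearMap

noncomputable section

universe u

variable {X : Type u} [NormedAddCommGroup X] [NormedSpace ℝ X]

variable {X1 : Type u} {X2 : Type u} [NormedAddCommGroup X1] [NormedSpace ℝ X1]
  [NormedAddCommGroup X2] [NormedSpace ℝ X2]

/-- Green kernel of an exponential dichotomy on `ℕ` with projections `P`: for `n ≤ m`, `F m n` is
the evolution from time `n` to time `m` restricted to the stable spaces, and for `m ≤ n`, `G m n`
is the backward evolution from time `n` to time `m` along the kernels of the projections. -/
structure GreenKernel {E : Type*} [NormedAddCommGroup E] [NormedSpace ℝ E]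
    (A P : ℕ → E →L[ℝ] E) (F G : ℕ → ℕ → E →L[ℝ] E) (K α : ℝ) : Prop where
  K_pos : 0 < K
  α_pos : 0 < α
  proj : ∀ n x, P n (P n x) = P n x
  F_self : ∀ n x, F n n x = P n x
  F_succ_left : ∀ {m n}, n ≤ m → ∀ x, F (m + 1) n x = A m (F m n x)
  F_succ_right : ∀ {m n}, n + 1 ≤ m → ∀ x, F m (n + 1) (A n x) = F m n x
  G_self : ∀ n x, G n n x = x - P n x
  G_succ_left : ∀ {m n}, m + 1 ≤ n → ∀ x, A m (G m n x) = G (m + 1) n x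
  G_succ_right : ∀ {m n}, m ≤ n → ∀ x, G m (n + 1) (A n x) = G m n x
  P_G : ∀ {m n}, m ≤ n → ∀ x, P m (G m n x) = 0
  G_P : ∀ {m n}, m ≤ n → ∀ x, G m n (P n x) = 0
  F_norm : ∀ {m n : ℕ}, n ≤ m → ‖F m n‖ ≤ K * Real.exp (-α * ((m : ℝ) - n))
  G_norm : ∀ {m n : ℕ}, m ≤ n → ‖G m n‖ ≤ K * Real.exp (-α * ((n : ℝ) - m))

namespace GreenKernel

section Basic

variable {E : Type*} [NormedAddCommGroup E] [NormedSpace ℝ E]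
  {A P : ℕ → E →L[ℝ] E} {F G : ℕ → ℕ → E →L[ℝ] E} {K α : ℝ}

theorem mono (h : GreenKernel A P F G K α) {K' : ℝ} (hK : K ≤ K') :
    GreenKernel A P F G K' α :=
  { h with
    K_pos := h.K_pos.trans_le hK
    F_norm := fun hmn => (h.F_norm hmn).trans (by gcongr)
    G_norm := fun hmn => (h.G_norm hmn).trans (by gcongr) }

theorem map_P (h : GreenKernel A P F G K α) (n : ℕ) (x : E) :
    A n (P n x) = P (n + 1) (A n x) := by
  rw [← h.F_self n, ← h.F_succ_left le_rfl, ← h.F_succ_right le_rfl, h.F_self]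

theorem P_F (h : GreenKernel A P F G K α) {m n : ℕ} (hmn : n ≤ m) (x : E) :
    P m (F m n x) = F m n x := by
  induction m, hmn using Nat.le_induction with
  | base => rw [h.F_self, h.proj]
  | succ m hmn ih => rw [h.F_succ_left hmn, ← h.map_P, ih]

theorem F_P (h : GreenKernel A P F G K α) {m n : ℕ} (hmn : n ≤ m) (x : E) :
    F m n (P n x) = F m n x := by
  induction m, hmn using Nat.le_induction with
  | base => rw [h.F_self, h.F_self, h.proj]
  | succ m hmn ih => rw [h.F_succ_left hmn, h.F_succ_left hmn, ih]

theorem P_norm (h : GreenKernel A P F G K α) (n : ℕ) : ‖P n‖ ≤ K := by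
  have h1 : F n n = P n := ContinuousLinearMap.ext (h.F_self n)
  simpa [h1] using h.F_norm (le_refl n)

/-- A bounded operator commuting with the dynamics preserves the stable spaces. -/
theorem P_commuting_P (h : GreenKernel A P F G K α) (R : E →L[ℝ] E)
    (hR : ∀ n x, A n (R x) = R (A n x)) (n : ℕ) (x : E) :
    P n (R (P n x)) = R (P n x) := by
  have key : ∀ m, n ≤ m → R (P n x) - P n (R (P n x)) = G n m (R (F m n x)) := by
    intro m hm
    induction m, hm using Nat.le_induction with
    | base => rw [h.F_self, h.G_self]
    | succ m hm ih => rw [ih, h.F_succ_left hm, ← hR, h.G_succ_right hm]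
  have bound : ∀ k : ℕ, ‖R (P n x) - P n (R (P n x))‖
      ≤ K * K * ‖R‖ * ‖x‖ * Real.exp (-α) ^ k := by
    intro k
    rw [key (n + k) (Nat.le_add_right n k)]
    have hG := h.G_norm (Nat.le_add_right n k)
    have hF := h.F_norm (Nat.le_add_right n k)
    have he : Real.exp (-α * (((n + k : ℕ) : ℝ) - n)) = Real.exp (-α) ^ k := by
      rw [← Real.exp_nat_mul]; congr 1; push_cast; ring
    rw [he] at hG hF
    have h1 : Real.exp (-α) ^ k ≤ 1 :=
      pow_le_one₀ (Real.exp_pos _).le (Real.exp_le_one_iff.2 (by linarith [h.α_pos]))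
    have hG' : ‖G n (n + k)‖ ≤ K :=
      hG.trans (mul_le_of_le_one_right h.K_pos.le h1)
    calc ‖G n (n + k) (R (F (n + k) n x))‖
        ≤ ‖G n (n + k)‖ * (‖R‖ * (‖F (n + k) n‖ * ‖x‖)) :=
          (G n (n + k)).le_opNorm_of_le (R.le_opNorm_of_le ((F (n + k) n).le_opNorm x))
      _ ≤ K * (‖R‖ * ((K * Real.exp (-α) ^ k) * ‖x‖)) := by
          have := h.K_pos.le
          gcongr
      _ = _ := by ring
  have hlim : Filter.Tendsto (fun k : ℕ => K * K * ‖R‖ * ‖x‖ * Real.exp (-α) ^ k)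
      Filter.atTop (nhds 0) := by
    simpa using (tendsto_pow_atTop_nhds_zero_of_lt_one (Real.exp_pos (-α)).le
      (Real.exp_lt_one_iff.2 (by linarith [h.α_pos]))).const_mul (K * K * ‖R‖ * ‖x‖)
  have h0 := ge_of_tendsto' hlim bound
  exact (sub_eq_zero.1 (norm_le_zero_iff.1 h0)).symm

/-- A Green kernel restricts to a direct summand of the system, included by `ι` and
with projection `ρ`, even if the summand is not invariant under the projections `P`. -/
theorem retract {E' : Type*} [NormedAddCommGroup E'] [NormedSpace ℝ E']
    {B : ℕ → E' →L[ℝ] E'} (h : GreenKernel A P F G K α)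
    (ι : E' →L[ℝ] E) (ρ : E →L[ℝ] E') (hρι : ∀ x, ρ (ι x) = x)
    (hι : ∀ n x, A n (ι x) = ι (B n x)) (hρ : ∀ n x, ρ (A n x) = B n (ρ x)) :
    ∃ P' F' G' K', GreenKernel B P' F' G' K' α := by
  have hR : ∀ n x, P n (ι (ρ (P n x))) = ι (ρ (P n x)) := fun n x =>
    h.P_commuting_P (ι.comp ρ) (fun n x => by simp [hι, hρ]) n x
  have hproj : ∀ n x, ρ (P n (ι (ρ (P n (ι x))))) = ρ (P n (ι x)) := fun n x => by
    rw [hR, hρι]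
  set p : ℕ → E' →L[ℝ] E' := fun n => (ρ.comp (P n)).comp ι with hp
  have hpA : ∀ n x, B n (p n x) = p (n + 1) (B n x) := fun n x => by
    simp [hp, ← hρ, h.map_P, hι]
  have hpn : ∀ n, ‖p n‖ ≤ ‖ρ‖ * K * ‖ι‖ := fun n => by
    refine (opNorm_comp_le _ _).trans ?_
    gcongr
    refine (opNorm_comp_le _ _).trans ?_
    gcongr
    exact h.P_norm n
  have hK := h.K_pos
  have hc : 0 ≤ ‖ρ‖ * K * ‖ι‖ := by positivity
  refine ⟨p, fun m n => (ρ.comp (F m n)).comp ι,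
    fun m n => (ContinuousLinearMap.id ℝ E' - p m).comp ((ρ.comp (G m n)).comp ι),
    (1 + ‖ρ‖ * K * ‖ι‖) * (1 + ‖ρ‖ * K * ‖ι‖), ?_⟩
  refine
    { K_pos := by positivity
      α_pos := h.α_pos
      proj := fun n x => hproj n x
      F_self := fun n x => by simp [hp, h.F_self]
      F_succ_left := fun hmn x => by simp [h.F_succ_left hmn, hρ]
      F_succ_right := fun hmn x => by simp [← hι, h.F_succ_right hmn]
      G_self := fun n x => by simp [hp, h.G_self, hproj, hρι]
      G_succ_left := fun {m n} hmn x => by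
        simp [map_sub, hpA, ← hρ, h.G_succ_left hmn]
      G_succ_right := fun hmn x => by simp [← hι, h.G_succ_right hmn]
      P_G := fun hmn x => by simp [hp, hproj]
      G_P := fun {m n} hmn x => by
        have : G m n (ι (ρ (P n (ι x)))) = 0 := by rw [← hR, h.G_P hmn]
        simp [hp, this]
      F_norm := fun {m n} hmn => ?_
      G_norm := fun {m n} hmn => ?_ }
  · calc ‖(ρ.comp (F m n)).comp ι‖ ≤ ‖ρ‖ * ‖F m n‖ * ‖ι‖ :=
          (opNorm_comp_le _ _).trans (by gcongr; exact opNorm_comp_le _ _)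
      _ ≤ ‖ρ‖ * (K * Real.exp (-α * ((m : ℝ) - n))) * ‖ι‖ := by
          gcongr; exact h.F_norm hmn
      _ = (‖ρ‖ * K * ‖ι‖) * Real.exp (-α * ((m : ℝ) - n)) := by ring
      _ ≤ _ := mul_le_mul_of_nonneg_right (by nlinarith) (Real.exp_pos _).le
  · have h1 : ‖(ρ.comp (G m n)).comp ι‖
        ≤ (‖ρ‖ * K * ‖ι‖) * Real.exp (-α * ((n : ℝ) - m)) := by
      calc ‖(ρ.comp (G m n)).comp ι‖ ≤ ‖ρ‖ * ‖G m n‖ * ‖ι‖ :=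
            (opNorm_comp_le _ _).trans (by gcongr; exact opNorm_comp_le _ _)
        _ ≤ ‖ρ‖ * (K * Real.exp (-α * ((n : ℝ) - m))) * ‖ι‖ := by
            gcongr; exact h.G_norm hmn
        _ = _ := by ring
    have h2 : ‖ContinuousLinearMap.id ℝ E' - p m‖ ≤ 1 + ‖ρ‖ * K * ‖ι‖ :=
      (norm_sub_le _ _).trans (_root_.add_le_add norm_id_le (hpn m))
    calc _ ≤ _ := opNorm_comp_le _ _
      _ ≤ (1 + ‖ρ‖ * K * ‖ι‖) * ((‖ρ‖ * K * ‖ι‖) * Real.exp (-α * ((n : ℝ) - m))) := by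
          gcongr
      _ ≤ (1 + ‖ρ‖ * K * ‖ι‖) * ((1 + ‖ρ‖ * K * ‖ι‖) * Real.exp (-α * ((n : ℝ) - m))) := by
          gcongr; linarith
      _ = _ := by ring

end Basic

/-- The block upper triangular operator `(x, y) ↦ (a x + b y, d y)`. -/
def blockUpper {E₁ E₂ : Type*} [NormedAddCommGroup E₁] [NormedSpace ℝ E₁]
    [NormedAddCommGroup E₂] [NormedSpace ℝ E₂] (a : E₁ →L[ℝ] E₁) (b : E₂ →L[ℝ] E₁)
    (d : E₂ →L[ℝ] E₂) : (E₁ × E₂) →L[ℝ] E₁ × E₂ :=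
  (a.comp (fst ℝ E₁ E₂) + b.comp (snd ℝ E₁ E₂)).prod (d.comp (snd ℝ E₁ E₂))

section Triangular

variable {E₁ E₂ : Type*} [NormedAddCommGroup E₁] [NormedSpace ℝ E₁]
  [NormedAddCommGroup E₂] [NormedSpace ℝ E₂]
  {A₁ P₁ : ℕ → E₁ →L[ℝ] E₁} {F₁ G₁ : ℕ → ℕ → E₁ →L[ℝ] E₁}
  {A₂ P₂ : ℕ → E₂ →L[ℝ] E₂} {F₂ G₂ : ℕ → ℕ → E₂ →L[ℝ] E₂} {K α C : ℝ}
  {B : ℕ → E₂ →L[ℝ] E₁}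

theorem _root_.ContinuousLinearMap.norm_comp_comp_le
    {V W X Y : Type*} [NormedAddCommGroup V] [NormedSpace ℝ V] [NormedAddCommGroup W]
    [NormedSpace ℝ W] [NormedAddCommGroup X] [NormedSpace ℝ X] [NormedAddCommGroup Y]
    [NormedSpace ℝ Y] {f : X →L[ℝ] Y} {g : W →L[ℝ] X} {k : V →L[ℝ] W} {a b c : ℝ}
    (hf : ‖f‖ ≤ a) (hg : ‖g‖ ≤ b) (hk : ‖k‖ ≤ c) : ‖f.comp (g.comp k)‖ ≤ a * (b * c) := by
  have ha := (norm_nonneg f).trans hf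
  have hb := (norm_nonneg g).trans hg
  have hc := (norm_nonneg k).trans hk
  refine (opNorm_comp_le _ _).trans ?_
  gcongr
  refine (opNorm_comp_le _ _).trans ?_
  gcongr

/-- Bounded solution `M` of `M(n+1) A₂(n) = A₁(n) M(n) + P₁(n+1) B(n) (1 - P₂(n))`. -/
theorem exists_stable_unstable_coupling (h₁ : GreenKernel A₁ P₁ F₁ G₁ K α)
    (h₂ : GreenKernel A₂ P₂ F₂ G₂ K α) (hB : ∀ n, ‖B n‖ ≤ C) :
    ∃ (M : ℕ → E₂ →L[ℝ] E₁) (c : ℝ), (∀ n, ‖M n‖ ≤ c) ∧ (∀ n x, P₁ n (M n x) = M n x) ∧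
      (∀ n x, M n (P₂ n x) = 0) ∧
      ∀ n x, M (n + 1) (A₂ n x) = A₁ n (M n x) + P₁ (n + 1) (B n (x - P₂ n x)) := by
  have hK := h₁.K_pos
  have hα := h₁.α_pos
  have hC : 0 ≤ C := (norm_nonneg _).trans (hB 0)
  have hr1 : Real.exp (-α) < 1 := Real.exp_lt_one_iff.2 (by linarith)
  refine ⟨fun n => ∑ j ∈ Finset.range n, (F₁ n (j + 1)).comp ((B j).comp (G₂ j n)),
    K * (C * K) * (1 - Real.exp (-α))⁻¹, ?_, ?_, ?_, ?_⟩
  · intro n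
    calc _ ≤ ∑ j ∈ Finset.range n, K * (C * K) * Real.exp (-α) ^ (n - 1 - j) := by
          refine norm_sum_le_of_le _ fun j hj => ?_
          have hj : j + 1 ≤ n := Finset.mem_range.1 hj
          have hF := h₁.F_norm hj
          have hG : ‖G₂ j n‖ ≤ K := (h₂.G_norm (Nat.le_of_succ_le hj)).trans
            (mul_le_of_le_one_right hK.le (Real.exp_le_one_iff.2 (by
              have : (j : ℝ) ≤ n := by exact_mod_cast Nat.le_of_succ_le hj
              nlinarith)))
          have he : Real.exp (-α * ((n : ℝ) - (j + 1 : ℕ))) = Real.exp (-α) ^ (n - 1 - j) := by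
            rw [← Real.exp_nat_mul, Nat.sub_sub, add_comm 1 j, Nat.cast_sub hj]
            congr 1; ring
          rw [he] at hF
          refine (norm_comp_comp_le hF (hB j) hG).trans (le_of_eq ?_)
          ring
      _ = K * (C * K) * ∑ j ∈ Finset.range n, Real.exp (-α) ^ j := by
          rw [← Finset.mul_sum, Finset.sum_range_reflect (fun j => Real.exp (-α) ^ j) n]
      _ ≤ _ := by
          gcongr
          exact sum_le_hasSum _ (fun j _ => by positivity)
            (hasSum_geometric_of_lt_one (Real.exp_pos _).le hr1)
  · intro n x
    simp only [sum_apply, map_sum, comp_apply]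
    exact Finset.sum_congr rfl fun j hj => h₁.P_F (Finset.mem_range.1 hj) _
  · intro n x
    simp only [sum_apply, comp_apply]
    exact Finset.sum_eq_zero fun j hj => by rw [h₂.G_P (Finset.mem_range.1 hj).le]; simp
  · intro n x
    simp only [sum_apply, map_sum, comp_apply]
    rw [Finset.sum_range_succ, h₂.G_succ_right le_rfl, h₂.G_self, h₁.F_self]
    congr 1
    refine Finset.sum_congr rfl fun j hj => ?_
    have hj : j + 1 ≤ n := Finset.mem_range.1 hj
    rw [h₂.G_succ_right (Nat.le_of_succ_le hj), h₁.F_succ_left hj]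

/-- Bounded solution `N` of `N(n+1) A₂(n) = A₁(n) N(n) + (1 - P₁(n+1)) B(n) P₂(n)`. -/
theorem exists_unstable_stable_coupling [CompleteSpace E₁] (h₁ : GreenKernel A₁ P₁ F₁ G₁ K α)
    (h₂ : GreenKernel A₂ P₂ F₂ G₂ K α) (hB : ∀ n, ‖B n‖ ≤ C) :
    ∃ (N : ℕ → E₂ →L[ℝ] E₁) (c : ℝ), (∀ n, ‖N n‖ ≤ c) ∧ (∀ n x, P₁ n (N n x) = 0) ∧
      (∀ n x, N n (P₂ n x) = N n x) ∧
      ∀ n x, N (n + 1) (A₂ n x) = A₁ n (N n x) +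
        (B n (P₂ n x) - P₁ (n + 1) (B n (P₂ n x))) := by
  have hK := h₁.K_pos
  have hα := h₁.α_pos
  have hC : 0 ≤ C := (norm_nonneg _).trans (hB 0)
  have hr1 : Real.exp (-α) < 1 := Real.exp_lt_one_iff.2 (by linarith)
  set f : ℕ → ℕ → E₂ →L[ℝ] E₁ := fun n j =>
    (G₁ n (n + j + 1)).comp ((B (n + j)).comp (F₂ (n + j) n)) with hf
  have hfb : ∀ n j, ‖f n j‖ ≤ K * (C * K) * Real.exp (-α) ^ j := by
    intro n j
    have hF := h₂.F_norm (Nat.le_add_right n j)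
    have hG : ‖G₁ n (n + j + 1)‖ ≤ K := (h₁.G_norm (by omega)).trans
      (mul_le_of_le_one_right hK.le (Real.exp_le_one_iff.2 (by
        push_cast
        have : (0 : ℝ) ≤ j := by positivity
        nlinarith)))
    have he : Real.exp (-α * (((n + j : ℕ) : ℝ) - n)) = Real.exp (-α) ^ j := by
      rw [← Real.exp_nat_mul]; congr 1; push_cast; ring
    rw [he] at hF
    calc ‖f n j‖ ≤ K * (C * (K * Real.exp (-α) ^ j)) := norm_comp_comp_le hG (hB (n + j)) hF
      _ = _ := by ring
  have hg := (hasSum_geometric_of_lt_one (Real.exp_pos (-α)).le hr1).mul_left (K * (C * K))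
  have hsum : ∀ n x, HasSum (fun j => f n j x) ((∑' j, f n j) x) := fun n x => by
    have hs : Summable (f n) := Summable.of_norm_bounded hg.summable (hfb n)
    have h0 := (ContinuousLinearMap.apply ℝ E₁ x).hasSum hs.hasSum
    simpa only [Function.comp_def, apply_apply] using h0
  refine ⟨fun n => -∑' j, f n j, K * (C * K) * (1 - Real.exp (-α))⁻¹,
    fun n => ?_, fun n x => ?_, fun n x => ?_, fun n x => ?_⟩
  · rw [norm_neg]
    exact tsum_of_norm_bounded hg (hfb n)
  · have h0 := (P₁ n).hasSum (hsum n x)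
    have hz : ∀ j, P₁ n (f n j x) = 0 := fun j => h₁.P_G (by omega) _
    simp only [hz] at h0
    simp [h0.unique hasSum_zero]
  · have h0 := hsum n (P₂ n x)
    have hz : ∀ j, f n j (P₂ n x) = f n j x := fun j => by
      simp only [hf, comp_apply]; rw [h₂.F_P (by omega)]
    simp only [hz] at h0
    simp [h0.unique (hsum n x)]
  · have h0 := (A₁ n).hasSum (hsum n x)
    have h1 := hsum (n + 1) (A₂ n x)
    rw [← hasSum_nat_add_iff' 1] at h0
    have hz : ∀ j, A₁ n (f n (j + 1) x) = f (n + 1) j (A₂ n x) := fun j => by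
      simp only [hf, comp_apply]
      rw [h₁.G_succ_left (by omega), h₂.F_succ_right (by omega),
        show n + (j + 1) = n + 1 + j by omega]
    have hz0 : A₁ n (f n 0 x) = B n (P₂ n x) - P₁ (n + 1) (B n (P₂ n x)) := by
      simp only [hf, comp_apply, add_zero]
      rw [h₁.G_succ_left le_rfl, h₁.G_self, h₂.F_self]
    simp only [hz, Finset.sum_range_one, hz0] at h0
    have h2 := h0.unique h1
    simp only [_root_.neg_apply, map_neg, ← h2]
    abel

@[simp]
theorem blockUpper_apply (a : E₁ →L[ℝ] E₁) (b : E₂ →L[ℝ] E₁) (d : E₂ →L[ℝ] E₂) (x : E₁ × E₂) :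
    blockUpper a b d x = (a x.1 + b x.2, d x.2) := rfl

theorem norm_blockUpper_le (a : E₁ →L[ℝ] E₁) (b : E₂ →L[ℝ] E₁) (d : E₂ →L[ℝ] E₂) :
    ‖blockUpper a b d‖ ≤ ‖a‖ + ‖b‖ + ‖d‖ := by
  refine opNorm_le_bound _ (by positivity) fun x => ?_
  have ha := a.le_opNorm_of_le (norm_fst_le x)
  have hb := b.le_opNorm_of_le (norm_snd_le x)
  have hd := d.le_opNorm_of_le (norm_snd_le x)
  have h0 := norm_nonneg (a x.1)
  have h1 := norm_nonneg (d x.2)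
  have h2 := norm_nonneg (b x.2)
  rw [blockUpper_apply, Prod.norm_mk]
  refine max_le ((norm_add_le _ _).trans ?_) ?_ <;> linarith

theorem mul_exp_neg_le {α : ℝ} (hα : 0 < α) (t : ℝ) :
    t * Real.exp (-α * t) ≤ 2 / α * Real.exp (-(α / 2) * t) := by
  have h1 : α / 2 * t ≤ Real.exp (α / 2 * t) := by linarith [Real.add_one_le_exp (α / 2 * t)]
  have h2 : Real.exp (-α * t) = Real.exp (-(α / 2) * t) * Real.exp (-(α / 2) * t) := by
    rw [← Real.exp_add]; ring_nf
  have h3 : Real.exp (α / 2 * t) * Real.exp (-(α / 2) * t) = 1 := by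
    rw [← Real.exp_add]; simp
  have h4 : t * Real.exp (-(α / 2) * t) ≤ 2 / α := by
    rw [le_div_iff₀ hα]
    have := mul_le_mul_of_nonneg_right h1 (Real.exp_pos (-(α / 2) * t)).le
    rw [h3] at this
    linarith
  rw [h2, ← mul_assoc]
  exact mul_le_mul_of_nonneg_right h4 (Real.exp_pos _).le

theorem norm_triangular_entry_le {α K c c' D t : ℝ} {a : E₁ →L[ℝ] E₁} {d : E₂ →L[ℝ] E₂}
    {M N S : E₂ →L[ℝ] E₁} (hα : 0 < α) (hK : 0 < K) (ht : 0 ≤ t)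
    (ha : ‖a‖ ≤ K * Real.exp (-α * t)) (hd : ‖d‖ ≤ K * Real.exp (-α * t))
    (hM : ‖M‖ ≤ c) (hN : ‖N‖ ≤ c') (hD : 0 ≤ D) (hS : ‖S‖ ≤ D * (t * Real.exp (-α * t))) :
    ‖blockUpper a (S - a.comp M + N.comp d) d‖
      ≤ (K + (D * (2 / α) + K * c + c' * K) + K) * Real.exp (-(α / 2) * t) := by
  have hexp : Real.exp (-α * t) ≤ Real.exp (-(α / 2) * t) := Real.exp_le_exp.2 (by nlinarith)
  have hc := (norm_nonneg _).trans hM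
  have hc' := (norm_nonneg _).trans hN
  have ha' : ‖a‖ ≤ K * Real.exp (-(α / 2) * t) := ha.trans (by gcongr)
  have hd' : ‖d‖ ≤ K * Real.exp (-(α / 2) * t) := hd.trans (by gcongr)
  have hS' : ‖S‖ ≤ D * (2 / α * Real.exp (-(α / 2) * t)) :=
    hS.trans (mul_le_mul_of_nonneg_left (mul_exp_neg_le hα t) hD)
  have haM : ‖a.comp M‖ ≤ (K * Real.exp (-(α / 2) * t)) * c :=
    (opNorm_comp_le _ _).trans (by gcongr)
  have hNd : ‖N.comp d‖ ≤ c' * (K * Real.exp (-(α / 2) * t)) :=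
    (opNorm_comp_le _ _).trans (by gcongr)
  have h1 := norm_blockUpper_le a (S - a.comp M + N.comp d) d
  have h2 := norm_add_le (S - a.comp M) (N.comp d)
  have h3 := norm_sub_le S (a.comp M)
  linarith

/-- Dichotomies of the diagonal blocks give a dichotomy of the block triangular system. -/
theorem triangular [CompleteSpace E₁] (h₁ : GreenKernel A₁ P₁ F₁ G₁ K α)
    (h₂ : GreenKernel A₂ P₂ F₂ G₂ K α) (hB : ∀ n, ‖B n‖ ≤ C) :
    ∃ P F G K' α', GreenKernel (fun n => blockUpper (A₁ n) (B n) (A₂ n)) P F G K' α' := by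
  obtain ⟨M, c, hM, hPM, hMP, hMA⟩ := exists_stable_unstable_coupling h₁ h₂ hB
  obtain ⟨N, c', hN, hPN, hNP, hNA⟩ := exists_unstable_stable_coupling h₁ h₂ hB
  have hK := h₁.K_pos
  have hα := h₁.α_pos
  have hC : 0 ≤ C := (norm_nonneg _).trans (hB 0)
  have hc : 0 ≤ c := (norm_nonneg _).trans (hM 0)
  have hc' : 0 ≤ c' := (norm_nonneg _).trans (hN 0)
  have hGM : ∀ {m n}, m ≤ n → ∀ x, G₁ m n (M n x) = 0 := fun {m n} hmn x => by
    rw [← hPM, h₁.G_P hmn]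
  have hNG : ∀ {m n}, m ≤ n → ∀ x, N m (G₂ m n x) = 0 := fun {m n} hmn x => by
    rw [← hNP, h₂.P_G hmn, map_zero]
  set Z : ℕ → ℕ → E₂ →L[ℝ] E₁ := fun m n =>
    ∑ j ∈ Finset.Ico n m, (F₁ m (j + 1)).comp ((B j).comp (F₂ j n)) with hZ
  set W : ℕ → ℕ → E₂ →L[ℝ] E₁ := fun m n =>
    -∑ j ∈ Finset.Ico m n, (G₁ m (j + 1)).comp ((B j).comp (G₂ j n)) with hW
  have hZself : ∀ n, Z n n = 0 := fun n => by simp [hZ]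
  have hWself : ∀ n, W n n = 0 := fun n => by simp [hW]
  have hZleft : ∀ {m n}, n ≤ m → ∀ x,
      Z (m + 1) n x = A₁ m (Z m n x) + P₁ (m + 1) (B m (F₂ m n x)) := fun {m n} hmn x => by
    simp only [hZ, sum_apply, comp_apply, map_sum]
    rw [Finset.sum_Ico_succ_top hmn, h₁.F_self]
    congr 1
    exact Finset.sum_congr rfl fun j hj => h₁.F_succ_left (Finset.mem_Ico.1 hj).2 _
  have hZright : ∀ {m n}, n + 1 ≤ m → ∀ x,
      Z m n x = F₁ m (n + 1) (B n (P₂ n x)) + Z m (n + 1) (A₂ n x) := fun {m n} hmn x => by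
    simp only [hZ, sum_apply, comp_apply]
    rw [Finset.sum_eq_sum_Ico_succ_bot hmn, h₂.F_self]
    congr 1
    refine Finset.sum_congr rfl fun j hj => ?_
    rw [h₂.F_succ_right (Finset.mem_Ico.1 hj).1]
  have hWleft : ∀ {m n}, m + 1 ≤ n → ∀ x, A₁ m (W m n x) = W (m + 1) n x
      - (B m (G₂ m n x) - P₁ (m + 1) (B m (G₂ m n x))) := fun {m n} hmn x => by
    simp only [hW, _root_.neg_apply, sum_apply, comp_apply, map_sum, map_neg]
    rw [Finset.sum_eq_sum_Ico_succ_bot hmn, h₁.G_succ_left le_rfl, h₁.G_self, neg_add, add_comm,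
      ← sub_eq_add_neg]
    congr 2
    refine Finset.sum_congr rfl fun j hj => ?_
    rw [h₁.G_succ_left (by have := (Finset.mem_Ico.1 hj).1; omega)]
  have hWright : ∀ {m n}, m ≤ n → ∀ x, W m (n + 1) (A₂ n x) = W m n x
      - G₁ m (n + 1) (B n (x - P₂ n x)) := fun {m n} hmn x => by
    simp only [hW, _root_.neg_apply, sum_apply, comp_apply]
    rw [Finset.sum_Ico_succ_top hmn, h₂.G_succ_right le_rfl, h₂.G_self, neg_add,
      ← sub_eq_add_neg]
    congr 2
    refine Finset.sum_congr rfl fun j hj => ?_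
    rw [h₂.G_succ_right (Finset.mem_Ico.1 hj).2.le]
  have hPW : ∀ {m n}, m ≤ n → ∀ x, P₁ m (W m n x) = 0 := fun {m n} hmn x => by
    simp only [hW, _root_.neg_apply, sum_apply, comp_apply, map_sum, map_neg, neg_eq_zero]
    exact Finset.sum_eq_zero fun j hj =>
      h₁.P_G (by have := (Finset.mem_Ico.1 hj).1; omega) _
  have hWP : ∀ {m n}, m ≤ n → ∀ x, W m n (P₂ n x) = 0 := fun {m n} hmn x => by
    simp only [hW, _root_.neg_apply, sum_apply, comp_apply, neg_eq_zero]
    exact Finset.sum_eq_zero fun j hj => by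
      rw [h₂.G_P (Finset.mem_Ico.1 hj).2.le, map_zero, map_zero]
  have hZn : ∀ {m n : ℕ}, n ≤ m → ‖Z m n‖ ≤ K * (C * K) * Real.exp α *
      (((m : ℝ) - n) * Real.exp (-α * ((m : ℝ) - n))) := fun {m n} hmn => by
    calc ‖Z m n‖ ≤ ∑ j ∈ Finset.Ico n m,
          K * (C * K) * Real.exp α * Real.exp (-α * ((m : ℝ) - n)) := by
          refine norm_sum_le_of_le _ fun j hj => ?_
          obtain ⟨hj1, hj2⟩ := Finset.mem_Ico.1 hj
          refine (norm_comp_comp_le (h₁.F_norm hj2) (hB j) (h₂.F_norm hj1)).trans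
            (le_of_eq ?_)
          have : Real.exp (-α * ((m : ℝ) - (j + 1 : ℕ))) * Real.exp (-α * ((j : ℝ) - n))
              = Real.exp α * Real.exp (-α * ((m : ℝ) - n)) := by
            rw [← Real.exp_add, ← Real.exp_add]; push_cast; ring_nf
          linear_combination K * (C * K) * this
      _ = _ := by
          rw [Finset.sum_const, Nat.card_Ico, nsmul_eq_mul, Nat.cast_sub hmn]; ring
  have hWn : ∀ {m n : ℕ}, m ≤ n → ‖W m n‖ ≤ K * (C * K) * Real.exp α *
      (((n : ℝ) - m) * Real.exp (-α * ((n : ℝ) - m))) := fun {m n} hmn => by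
    calc ‖W m n‖ = ‖∑ j ∈ Finset.Ico m n, (G₁ m (j + 1)).comp ((B j).comp (G₂ j n))‖ :=
          norm_neg _
      _ ≤ ∑ j ∈ Finset.Ico m n,
          K * (C * K) * Real.exp α * Real.exp (-α * ((n : ℝ) - m)) := by
          refine norm_sum_le_of_le _ fun j hj => ?_
          obtain ⟨hj1, hj2⟩ := Finset.mem_Ico.1 hj
          refine (norm_comp_comp_le (h₁.G_norm (hj1.trans j.le_succ)) (hB j)
            (h₂.G_norm hj2.le)).trans ?_
          have : Real.exp (-α * (((j + 1 : ℕ) : ℝ) - m)) * Real.exp (-α * ((n : ℝ) - j))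
              ≤ Real.exp α * Real.exp (-α * ((n : ℝ) - m)) := by
            rw [← Real.exp_add, ← Real.exp_add]
            refine Real.exp_le_exp.2 ?_
            push_cast
            linarith
          have h0 : 0 ≤ K * (C * K) := by positivity
          linarith [mul_le_mul_of_nonneg_left this h0]
      _ = _ := by
          rw [Finset.sum_const, Nat.card_Ico, nsmul_eq_mul, Nat.cast_sub hmn]; ring
  have hD : 0 ≤ K * (C * K) * Real.exp α := by positivity
  have hgreen : GreenKernel (fun n => blockUpper (A₁ n) (B n) (A₂ n))
      (fun n => blockUpper (P₁ n) (N n - M n) (P₂ n))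
      (fun m n => blockUpper (F₁ m n) (Z m n - (F₁ m n).comp (M n) + (N m).comp (F₂ m n)) (F₂ m n))
      (fun m n => blockUpper (G₁ m n) (W m n - (G₁ m n).comp (N n) + (M m).comp (G₂ m n)) (G₂ m n))
      ((K + (K * (C * K) * Real.exp α * (2 / α) + K * c + c' * K) + K) +
        (K + (K * (C * K) * Real.exp α * (2 / α) + K * c' + c * K) + K)) (α / 2) :=
    { K_pos := by positivity
      α_pos := by positivity
      proj := fun n x => by
        ext <;> simp [h₁.proj, h₂.proj, hPM, hPN, hMP, hNP]
        abel
      F_self := fun n x => by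
        ext <;> simp [h₁.F_self, h₂.F_self, hPM, hNP, hZself]
        abel
      F_succ_left := fun {m n} hmn x => by
        ext <;> simp [h₁.F_succ_left hmn, h₂.F_succ_left hmn, hZleft hmn, hNA, h₂.P_F hmn]
        abel
      F_succ_right := fun {m n} hmn x => by
        ext <;> simp [h₁.F_succ_right hmn, h₂.F_succ_right hmn, hZright hmn, hMA, h₁.F_P hmn]
        abel
      G_self := fun n x => by
        ext <;> simp [h₁.G_self, h₂.G_self, hPN, hMP, hWself]
        abel
      G_succ_left := fun {m n} hmn x => by
        ext <;> simp [← h₁.G_succ_left hmn, ← h₂.G_succ_left hmn, hWleft hmn, hMA,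
          h₂.P_G (Nat.le_of_succ_le hmn)]
        abel
      G_succ_right := fun {m n} hmn x => by
        ext <;> simp [h₁.G_succ_right hmn, h₂.G_succ_right hmn, hWright hmn, hNA,
          h₁.G_P (Nat.le_succ_of_le hmn)]
        abel
      P_G := fun {m n} hmn x => by
        ext <;> simp [h₁.P_G hmn, h₂.P_G hmn, hPW hmn, hPM, hNG hmn]
      G_P := fun {m n} hmn x => by
        ext <;> simp [h₁.G_P hmn, h₂.G_P hmn, hWP hmn, hNP, hGM hmn]
      F_norm := fun {m n} hmn => by
        refine (norm_triangular_entry_le hα hK (sub_nonneg.2 (by exact_mod_cast hmn))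
          (h₁.F_norm hmn) (h₂.F_norm hmn) (hM n) (hN m) hD (hZn hmn)).trans ?_
        exact mul_le_mul_of_nonneg_right (le_add_of_nonneg_right 
          (by positivity : (0 : ℝ) ≤ K + (K * (C * K) * Real.exp α * (2 / α) + K * c' + c * K) + K))
          (Real.exp_pos _).le
      G_norm := fun {m n} hmn => by
        refine (norm_triangular_entry_le hα hK (sub_nonneg.2 (by exact_mod_cast hmn))
          (h₁.G_norm hmn) (h₂.G_norm hmn) (hN n) (hM m) hD (hWn hmn)).trans ?_
        exact mul_le_mul_of_nonneg_right (le_add_of_nonneg_left 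
          (by positivity : (0 : ℝ) ≤ K + (K * (C * K) * Real.exp α * (2 / α) + K * c + c' * K) + K))
          (Real.exp_pos _).le }
  exact ⟨_, _, _, _, _, hgreen⟩

end Triangular

end GreenKernel

section Cocycle

variable {E : Type*} [NormedAddCommGroup E] [NormedSpace ℝ E]

theorem Phi_self_s4 (A : ℤ → E →L[ℝ] E) (n : ℤ) (x : E) : Phi A n n x = x := by
  simp [Phi, cocycleAux]

theorem Phi_succ_left (A : ℤ → E →L[ℝ] E) {m n : ℤ} (h : n ≤ m) (x : E) :
    Phi A (m + 1) n x = A m (Phi A m n x) := by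
  obtain ⟨k, rfl⟩ := Int.le.dest h
  have h1 : (n + k + 1 - n).toNat = k + 1 := by omega
  have h2 : (n + k - n).toNat = k := by omega
  simp [Phi, h1, cocycleAux]

theorem Phi_succ_right (A : ℤ → E →L[ℝ] E) {m n : ℤ} (h : n + 1 ≤ m) (x : E) :
    Phi A m (n + 1) (A n x) = Phi A m n x := by
  induction m, h using Int.leInduction with
  | base => rw [Phi_self_s4, Phi_succ_left A le_rfl, Phi_self_s4]
  | succ m h ih => rw [Phi_succ_left A h, ih, Phi_succ_left A (by omega)]

theorem ExpDichotomy.exists_greenKernel {A : ℤ → E →L[ℝ] E}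
    (h : ExpDichotomy {n : ℤ | 0 ≤ n} {n : ℤ | 0 ≤ n} A) :
    ∃ P F G K α, GreenKernel (fun n : ℕ => A n) P F G K α := by
  obtain ⟨P, K, α, hK, hα, hproj, hcomm, hbij, hF, hG⟩ := h
  have hcomm' : ∀ (n : ℕ) x, A n (P n x) = P (n + 1) (A n x) := fun n x =>
    DFunLike.congr_fun (hcomm n (Int.natCast_nonneg n)) x
  have hproj' : ∀ (n : ℕ) x, P n (P n x) = P n x := fun n x =>
    DFunLike.congr_fun (hproj n (Int.natCast_nonneg n)) x
  have huniq : ∀ {m n : ℕ}, m ≤ n → ∀ {x y}, P m x = 0 → P m y = 0 →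
      Phi A n m x = Phi A n m y → x = y := by
    intro m n hmn x y hx hy hxy
    have h0 := hG m n (Int.natCast_nonneg m) (Int.natCast_nonneg n) (by exact_mod_cast hmn)
      (x - y) 0 (by simp [hx, hy]) (by simp [hxy])
    rw [norm_zero, mul_zero] at h0
    exact sub_eq_zero.1 (norm_le_zero_iff.1 h0)
  have hsurj : ∀ {m n : ℕ}, m ≤ n → ∀ y, P n y = 0 → ∃ x, P m x = 0 ∧ Phi A n m x = y := by
    intro m n hmn
    induction n, hmn using Nat.le_induction with
    | base => exact fun y hy => ⟨y, hy, Phi_self_s4 A m y⟩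
    | succ n hmn ih =>
      intro y hy
      obtain ⟨z, hz, hzy⟩ := (hbij n (Int.natCast_nonneg n)).surjOn (by simpa using hy)
      obtain ⟨x, hx, hxz⟩ := ih z hz
      refine ⟨x, hx, ?_⟩
      rw [Nat.cast_succ, Phi_succ_left A (by exact_mod_cast hmn), hxz, hzy]
  have hinv : ∀ m n : ℕ, ∃ G : E →L[ℝ] E, m ≤ n → (∀ y, P m (G y) = 0) ∧
      (∀ y, Phi A n m (G y) = y - P n y) ∧ ‖G‖ ≤ K * Real.exp (-α * ((n : ℝ) - m)) := by
    intro m n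
    by_cases hmn : m ≤ n
    swap
    · exact ⟨0, fun h => absurd h hmn⟩
    choose g hg1 hg2 using fun y : E => hsurj hmn (y - P n y) (by simp [hproj'])
    have hgn : ∀ y, ‖g y‖ ≤ K * Real.exp (-α * ((n : ℝ) - m)) * ‖y‖ := fun y => by
      simpa using hG m n (Int.natCast_nonneg m) (Int.natCast_nonneg n) (by exact_mod_cast hmn)
        (g y) y (hg1 y) (hg2 y)
    let gl : E →ₗ[ℝ] E :=
      { toFun := g
        map_add' := fun x y => huniq hmn (hg1 _) (by simp [hg1]) (by
          simp only [map_add, hg2]; abel)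
        map_smul' := fun a x => huniq hmn (hg1 _) (by simp [hg1]) (by
          simp [hg2, smul_sub]) }
    exact ⟨gl.mkContinuous _ hgn, fun _ => ⟨hg1, hg2,
      gl.mkContinuous_norm_le (by positivity) hgn⟩⟩
  choose G hG' using hinv
  have hPG : ∀ {m n : ℕ}, m ≤ n → ∀ y, P m (G m n y) = 0 := fun h => (hG' _ _ h).1
  have hPhiG : ∀ {m n : ℕ}, m ≤ n → ∀ y, Phi A n m (G m n y) = y - P n y :=
    fun h => (hG' _ _ h).2.1
  refine ⟨fun n => P n, fun m n => (Phi A m n).comp (P n), G, K, α, ?_⟩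
  exact
    { K_pos := hK
      α_pos := hα
      proj := hproj'
      F_self := fun n x => by simp [Phi_self_s4]
      F_succ_left := fun hmn x => by
        simp [Phi_succ_left A (Int.ofNat_le.2 hmn)]
      F_succ_right := fun {m n} hmn x => by
        have : (n : ℤ) + 1 ≤ m := by exact_mod_cast hmn
        simp [← hcomm', Phi_succ_right A this]
      G_self := fun n x => by
        rw [← hPhiG le_rfl, Phi_self_s4]
      G_succ_left := fun {m n} hmn x => by
        have hmn' : (m : ℤ) + 1 ≤ n := by exact_mod_cast hmn
        refine huniq hmn ?_ (hPG hmn x) ?_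
        · rw [Nat.cast_succ, ← hcomm', hPG (Nat.le_of_succ_le hmn), map_zero]
        · rw [hPhiG hmn, Nat.cast_succ, Phi_succ_right A hmn', hPhiG (Nat.le_of_succ_le hmn)]
      G_succ_right := fun {m n} hmn x => by
        refine huniq (Nat.le_succ_of_le hmn) (hPG (Nat.le_succ_of_le hmn) _) (hPG hmn x) ?_
        rw [hPhiG (Nat.le_succ_of_le hmn), Nat.cast_succ,
          Phi_succ_left A (by exact_mod_cast hmn), hPhiG hmn, map_sub, hcomm']
      P_G := hPG
      G_P := fun {m n} hmn x => huniq hmn (hPG hmn _) (map_zero _) (by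
        rw [hPhiG hmn, hproj', sub_self, map_zero])
      F_norm := fun {m n} hmn => by
        simpa using hF m n (Int.natCast_nonneg m) (Int.natCast_nonneg n) (by exact_mod_cast hmn)
      G_norm := fun hmn => (hG' _ _ hmn).2.2 }

theorem GreenKernel.expDichotomy {A : ℤ → E →L[ℝ] E} {P : ℕ → E →L[ℝ] E}
    {F G : ℕ → ℕ → E →L[ℝ] E} {K α : ℝ} (h : GreenKernel (fun n : ℕ => A n) P F G K α) :
    ExpDichotomy {n : ℤ | 0 ≤ n} {n : ℤ | 0 ≤ n} A := by
  have hF : ∀ {m n : ℕ}, n ≤ m → ∀ x, Phi A m n (P n x) = F m n x := by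
    intro m n hmn x
    induction m, hmn using Nat.le_induction with
    | base => rw [Phi_self_s4, h.F_self]
    | succ m hmn ih =>
      rw [Nat.cast_succ, Phi_succ_left A (by exact_mod_cast hmn), ih, h.F_succ_left hmn]
  have hG : ∀ {m n : ℕ}, m ≤ n → ∀ x, G m n (Phi A n m x) = x - P m x := by
    intro m n hmn x
    induction n, hmn using Nat.le_induction with
    | base => rw [Phi_self_s4, h.G_self]
    | succ n hmn ih =>
      rw [Nat.cast_succ, Phi_succ_left A (by exact_mod_cast hmn), h.G_succ_right hmn, ih]
  have hsucc : ∀ n : ℕ, ((n : ℤ) + 1).toNat = n + 1 := fun n => by omega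
  refine ⟨fun n => P n.toNat, K, α, h.K_pos, h.α_pos, ?_, ?_, ?_, ?_, ?_⟩
  · exact fun n _ => ContinuousLinearMap.ext (h.proj _)
  · intro n hn
    lift n to ℕ using hn
    ext x
    simpa [hsucc] using h.map_P n x
  · intro n hn
    lift n to ℕ using hn
    simp only [hsucc, Int.toNat_natCast]
    refine ⟨fun x hx => ?_, fun x hx y hy hxy => ?_, fun y hy => ?_⟩
    · have hx : P n x = 0 := hx
      show P (n + 1) (A n x) = 0
      rw [← h.map_P, hx, map_zero]
    · have hx : P n x = 0 := hx
      have hy : P n y = 0 := hy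
      have hxG := h.G_succ_right (le_refl n) x
      have hyG := h.G_succ_right (le_refl n) y
      rw [h.G_self, hx, sub_zero] at hxG
      rw [h.G_self, hy, sub_zero] at hyG
      rw [← hxG, ← hyG, hxy]
    · have hy : P (n + 1) y = 0 := hy
      refine ⟨G n (n + 1) y, h.P_G n.le_succ y, ?_⟩
      have := h.G_succ_left (le_refl (n + 1)) y
      rwa [h.G_self, hy, sub_zero] at this
  · intro m n hm hn hmn
    lift m to ℕ using hm
    lift n to ℕ using hn
    have hmn : n ≤ m := by exact_mod_cast hmn
    have : (Phi A m n).comp (P n) = F m n := ContinuousLinearMap.ext (hF hmn)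
    simpa [this] using h.F_norm hmn
  · intro m n hm hn hmn x y hx hxy
    lift m to ℕ using hm
    lift n to ℕ using hn
    have hmn : m ≤ n := by exact_mod_cast hmn
    simp only [Int.toNat_natCast] at hx hxy
    have h1 := hG hmn x
    rw [hxy, map_sub, h.G_P hmn, hx, sub_zero, sub_zero] at h1
    rw [← h1]
    simpa using (G m n).le_of_opNorm_le (h.G_norm hmn) y

end Cocycle

theorem triangular_dichotomy_of_diagonal_Zplus {H1 : Type u} {H2 : Type u}
    [NormedAddCommGroup H1] [InnerProductSpace ℝ H1] [CompleteSpace H1]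
    [NormedAddCommGroup H2] [InnerProductSpace ℝ H2] [CompleteSpace H2]
    (A11 : ℤ → H1 →L[ℝ] H1) (A12 : ℤ → H2 →L[ℝ] H1) (A22 : ℤ → H2 →L[ℝ] H2)
    (hdiag : ExpDichotomy {n : ℤ | 0 ≤ n} {n : ℤ | 0 ≤ n} (diagonal A11 A22))
    (hbdd : ∃ C : ℝ, ∀ n : ℤ, 0 ≤ n → ‖A12 n‖ ≤ C) :
    ExpDichotomy {n : ℤ | 0 ≤ n} {n : ℤ | 0 ≤ n} (triangular A11 A12 A22) := by
  obtain ⟨P, F, G, K, α, hD⟩ := hdiag.exists_greenKernel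
  obtain ⟨C, hC⟩ := hbdd
  obtain ⟨P₁, F₁, G₁, K₁, h₁⟩ := hD.retract (B := fun n : ℕ => A11 n) (inl ℝ H1 H2) (fst ℝ H1 H2)
    (fun x => rfl) (fun n x => by simp [diagonal]) (fun n x => by simp [diagonal])
  obtain ⟨P₂, F₂, G₂, K₂, h₂⟩ := hD.retract (B := fun n : ℕ => A22 n) (inr ℝ H1 H2) (snd ℝ H1 H2)
    (fun x => rfl) (fun n x => by simp [diagonal]) (fun n x => by simp [diagonal])
  obtain ⟨P', F', G', K', α', hT⟩ := (h₁.mono (le_max_left K₁ K₂)).triangular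
    (h₂.mono (le_max_right K₁ K₂)) (B := fun n : ℕ => A12 n)
    (fun n => hC n (Int.natCast_nonneg n))
  exact GreenKernel.expDichotomy (A := triangular A11 A12 A22) hT

end
end

section
/- Let J = Z+ and suppose the triangular system x(n+1) = (A11(n) A12(n); 0 A22(n)) x(n) admits an exponential dichotomy on Z+. If the subspace S2 := {v ∈ X2 : sup_{n∈Z+} ‖Φ22(n,0)v‖ < +∞} is complemented in X2, then the block system x2(n+1) = A22(n) x2(n) admits an exponential dichotomy on Z+. -/
open Real ContinuousLinearMap

noncomputable section

universe u

variable {X : Type u} [NormedAddCommGroup X] [NormedSpace ℝ X]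

variable {X1 : Type u} {X2 : Type u} [NormedAddCommGroup X1] [NormedSpace ℝ X1]
  [NormedAddCommGroup X2] [NormedSpace ℝ X2]

lemma cocycleAux_add (A : ℤ → X →L[ℝ] X) (n : ℤ) (k l : ℕ) (v : X) :
    cocycleAux A n (k + l) v = cocycleAux A (n + k) l (cocycleAux A n k v) := by
  induction l with
  | zero => rfl
  | succ l ih =>
    change A (n + ((k + l : ℕ) : ℤ)) (cocycleAux A n (k + l) v) = _
    rw [ih]
    push_cast
    rw [← add_assoc]
    rfl

lemma cocycleAux_zero_add (A : ℤ → X →L[ℝ] X) (k l : ℕ) (v : X) :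
    cocycleAux A 0 (k + l) v = cocycleAux A k l (cocycleAux A 0 k v) := by
  rw [cocycleAux_add, zero_add]

lemma cocycleAux_succ_apply (A : ℤ → X →L[ℝ] X) (n : ℤ) (k : ℕ) (v : X) :
    cocycleAux A n (k + 1) v = A (n + k) (cocycleAux A n k v) := rfl

lemma cocycleAux_zero_succ (A : ℤ → X →L[ℝ] X) (k : ℕ) (v : X) :
    cocycleAux A 0 (k + 1) v = A k (cocycleAux A 0 k v) := by
  rw [cocycleAux_succ_apply, zero_add]

lemma Phi_add (A : ℤ → X →L[ℝ] X) (n : ℤ) (k : ℕ) : Phi A (n + k) n = cocycleAux A n k := by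
  simp [Phi]

/-- The initial conditions at time `n` whose forward orbit is bounded. -/
def boundedForward (A : ℤ → X →L[ℝ] X) (n : ℤ) : Submodule ℝ X where
  carrier := {v | ∃ C : ℝ, ∀ k : ℕ, ‖cocycleAux A n k v‖ ≤ C}
  zero_mem' := ⟨0, fun k => by simp⟩
  add_mem' := by
    rintro v w ⟨C, hC⟩ ⟨D, hD⟩
    refine ⟨C + D, fun k => ?_⟩
    rw [map_add]
    exact (norm_add_le _ _).trans (add_le_add (hC k) (hD k))
  smul_mem' := by
    rintro c v ⟨C, hC⟩
    refine ⟨‖c‖ * C, fun k => ?_⟩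
    rw [map_smul, norm_smul]
    exact mul_le_mul_of_nonneg_left (hC k) (norm_nonneg c)

lemma mem_boundedForward {A : ℤ → X →L[ℝ] X} {n : ℤ} {v : X} :
    v ∈ boundedForward A n ↔ ∃ C : ℝ, ∀ k : ℕ, ‖cocycleAux A n k v‖ ≤ C := Iff.rfl

lemma coe_boundedForward_zero (A : ℤ → X →L[ℝ] X) :
    (boundedForward A 0 : Set X) = Sset A := by
  ext v
  constructor
  · rintro ⟨C, hC⟩
    exact ⟨C, fun n _ => by simpa [Phi] using hC n.toNat⟩
  · rintro ⟨C, hC⟩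
    exact ⟨C, fun k => by simpa [Phi] using hC k (Int.natCast_nonneg k)⟩

lemma cocycleAux_mem_boundedForward_iff {A : ℤ → X →L[ℝ] X} {n : ℤ} (k : ℕ) {v : X} :
    cocycleAux A n k v ∈ boundedForward A (n + k) ↔ v ∈ boundedForward A n := by
  simp only [mem_boundedForward, ← cocycleAux_add]
  constructor
  · rintro ⟨C, hC⟩
    refine ⟨∑ i ∈ Finset.range k, ‖cocycleAux A n i v‖ + C, fun l => ?_⟩
    have hC0 : 0 ≤ C := (norm_nonneg _).trans (hC 0)
    rcases lt_or_ge l k with h | h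
    · have := Finset.single_le_sum (f := fun i => ‖cocycleAux A n i v‖)
        (fun i _ => norm_nonneg _) (Finset.mem_range.2 h)
      linarith
    · obtain ⟨m, rfl⟩ := Nat.exists_eq_add_of_le h
      have := Finset.sum_nonneg (s := Finset.range k)
        (f := fun i => ‖cocycleAux A n i v‖) (fun i _ => norm_nonneg _)
      linarith [hC m]
  · rintro ⟨C, hC⟩
    exact ⟨C, fun l => hC (k + l)⟩

lemma cocycleAux_zero_mem_boundedForward_iff {A : ℤ → X →L[ℝ] X} (k : ℕ) {v : X} :
    cocycleAux A 0 k v ∈ boundedForward A k ↔ v ∈ boundedForward A 0 := by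
  simpa using cocycleAux_mem_boundedForward_iff (A := A) (n := 0) k (v := v)

/-- The projection onto the bounded initial conditions along a closed complement controls the
whole forward orbit, by the closed graph theorem. -/
lemma exists_projection_bound [CompleteSpace X] (A : ℤ → X →L[ℝ] X) (Z : Submodule ℝ X)
    (hZ : IsClosed (Z : Set X)) (hc : IsCompl (boundedForward A 0) Z) :
    ∃ C : ℝ, 0 ≤ C ∧ ∀ (k : ℕ) (v : X),
      ‖cocycleAux A 0 k ((boundedForward A 0).projection Z hc v)‖ ≤ C * ‖v‖ := by
  set Q := (boundedForward A 0).projection Z hc with hQ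
  have hmem : ∀ v, Q v ∈ boundedForward A 0 := Submodule.projection_apply_mem hc
  choose B hB using fun v => mem_boundedForward.1 (hmem v)
  let g : X →ₗ[ℝ] BoundedContinuousFunction ℕ X :=
    { toFun := fun v => BoundedContinuousFunction.ofNormedAddCommGroupDiscrete
        (fun k => cocycleAux A 0 k (Q v)) (B v) (hB v)
      map_add' := fun v w => by ext k; simp
      map_smul' := fun c v => by ext k; simp }
  have hg : ∀ v k, g v k = cocycleAux A 0 k (Q v) := fun v k => rfl
  have hcont : Continuous g := by
    refine g.continuous_of_seq_closed_graph fun u x y hu hy => ?_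
    have hyk : ∀ k, Filter.Tendsto (fun i => cocycleAux A 0 k (Q (u i))) Filter.atTop
        (nhds (y k)) := fun k =>
      ((continuous_eval_const k).tendsto y).comp hy
    have hy0 : Filter.Tendsto (fun i => Q (u i)) Filter.atTop (nhds (y 0)) := hyk 0
    have hyF : ∀ k, y k = cocycleAux A 0 k (y 0) := fun k =>
      tendsto_nhds_unique (hyk k) (((cocycleAux A 0 k).continuous.tendsto _).comp hy0)
    have hyS : y 0 ∈ boundedForward A 0 :=
      mem_boundedForward.2 ⟨‖y‖, fun k => by rw [← hyF]; exact y.norm_coe_le_norm k⟩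
    have hyZ : x - y 0 ∈ Z := by
      refine hZ.mem_of_tendsto (hu.sub hy0) (Filter.Eventually.of_forall fun i => ?_)
      change u i - Q (u i) ∈ Z
      rw [← Submodule.projection_apply_eq_zero_iff hc, map_sub, hQ,
        Submodule.projection_apply_of_mem_left hc (hmem _), sub_self]
    have hQx : Q x = y 0 := by
      have h1 : Q (x - y 0) = 0 := (Submodule.projection_apply_eq_zero_iff hc).2 hyZ
      have h2 : Q (y 0) = y 0 := Submodule.projection_apply_of_mem_left hc hyS
      rwa [map_sub, h2, sub_eq_zero] at h1
    ext k
    rw [hg, hQx, hyF]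
  let G : X →L[ℝ] BoundedContinuousFunction ℕ X := ⟨g, hcont⟩
  refine ⟨‖G‖, norm_nonneg _, fun k v => ?_⟩
  calc ‖cocycleAux A 0 k (Q v)‖ = ‖G v k‖ := rfl
    _ ≤ ‖G v‖ := (G v).norm_coe_le_norm k
    _ ≤ ‖G‖ * ‖v‖ := G.le_opNorm v

/-- For every impulse `v` applied at the positive time `n + 1`, the system has a solution on the
nonnegative integers which decays at rate `r` on both sides of the impulse. -/
def HasDecayingImpulseResponse (A : ℤ → X →L[ℝ] X) (K r : ℝ) : Prop :=
  ∀ (n : ℕ) (v : X), ∃ x : ℕ → X,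
    (∀ m : ℕ, x (m + 1) = A m (x m) + if m = n then v else 0) ∧
    (∀ k : ℕ, ‖x (n + 1 + k)‖ ≤ K * r ^ k * ‖v‖) ∧
    ∀ j l : ℕ, j + l = n + 1 → ‖x j‖ ≤ K * r ^ l * ‖v‖

/-- Every vector at time `n` splits into a bounded initial condition and the image of a vector
of the complement `Z`, with estimates on both orbits. -/
lemma exists_splitting [CompleteSpace X] (A : ℤ → X →L[ℝ] X) {K r : ℝ} (hK : 0 < K)
    (hr0 : 0 < r) (hr1 : r < 1) (hA : HasDecayingImpulseResponse A K r) (Z : Submodule ℝ X)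
    (hZ : IsClosed (Z : Set X)) (hc : IsCompl (boundedForward A 0) Z) :
    ∃ M : ℝ, 1 ≤ M ∧ ∀ (n : ℕ) (v : X), ∃ z ∈ Z,
      (∀ k : ℕ, ‖cocycleAux A n k (v - cocycleAux A 0 n z)‖ ≤ M * (r ^ k + r ^ n) * ‖v‖) ∧
      ∀ j l : ℕ, j + l = n → ‖cocycleAux A 0 j z‖ ≤ M * r ^ l * ‖v‖ := by
  obtain ⟨C, hC0, hC⟩ := exists_projection_bound A Z hZ hc
  set Q := (boundedForward A 0).projection Z hc with hQ
  have hmem : ∀ v, Q v ∈ boundedForward A 0 := Submodule.projection_apply_mem hc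
  have hsub : ∀ v, v - Q v ∈ Z := fun v => by
    rw [← Submodule.projection_apply_eq_zero_iff hc, map_sub,
      hQ, Submodule.projection_apply_of_mem_left hc (hmem _), sub_self]
  have hKC : 0 ≤ C * K := by positivity
  refine ⟨1 + C + K + C * K, by linarith, fun n v => ?_⟩
  have hv := norm_nonneg v
  rcases n with _ | n
  · refine ⟨v - Q v, hsub v, fun k => ?_, fun j l hjl => ?_⟩
    · have h1 : cocycleAux A ((0 : ℕ) : ℤ) k (v - cocycleAux A 0 0 (v - Q v))
          = cocycleAux A 0 k (Q v) := by
        simp [cocycleAux]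
      rw [h1]
      refine (hC k v).trans ?_
      have := pow_nonneg hr0.le k
      gcongr
      rw [pow_zero]
      nlinarith
    · obtain ⟨rfl, rfl⟩ : j = 0 ∧ l = 0 := by omega
      have h0 := hC 0 v
      change ‖Q v‖ ≤ _ at h0
      change ‖v - Q v‖ ≤ _
      have := norm_sub_le v (Q v)
      rw [pow_zero]
      nlinarith
  · obtain ⟨x, hx, hx1, hx2⟩ := hA n v
    have hpre : ∀ m ≤ n, x m = cocycleAux A 0 m (x 0) := by
      intro m
      induction m with
      | zero => intro _; rfl
      | succ m ih =>
        intro hm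
        rw [hx, ih (by omega), if_neg (by omega), add_zero, cocycleAux_zero_succ]
    have hxn : x (n + 1) = cocycleAux A 0 (n + 1) (x 0) + v := by
      rw [hx, hpre n le_rfl, if_pos rfl, cocycleAux_zero_succ]
    have hpost : ∀ k, x (n + 1 + k) = cocycleAux A ((n + 1 : ℕ) : ℤ) k (x (n + 1)) := by
      intro k
      induction k with
      | zero => rfl
      | succ k ih =>
        rw [← add_assoc, hx, if_neg (by omega), add_zero, ih, cocycleAux_succ_apply]
        push_cast
        rfl
    have hQ0 : ∀ m, ‖cocycleAux A 0 m (Q (x 0))‖ ≤ C * K * r ^ (n + 1) * ‖v‖ := fun m =>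
      calc _ ≤ C * ‖x 0‖ := hC m _
        _ ≤ C * (K * r ^ (n + 1) * ‖v‖) :=
          mul_le_mul_of_nonneg_left (hx2 0 (n + 1) (by omega)) hC0
        _ = _ := by ring
    have hneg : Q (x 0) - x 0 ∈ Z := by
      rw [← neg_sub]
      exact Z.neg_mem (hsub _)
    have hstab : ∀ k, ‖cocycleAux A ((n + 1 : ℕ) : ℤ) k
        (v - cocycleAux A 0 (n + 1) (Q (x 0) - x 0))‖
        ≤ (K * r ^ k + C * K * r ^ (n + 1)) * ‖v‖ := by
      intro k
      have h1 : v - cocycleAux A 0 (n + 1) (Q (x 0) - x 0)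
          = x (n + 1) - cocycleAux A 0 (n + 1) (Q (x 0)) := by
        rw [hxn, map_sub]; abel
      rw [h1, map_sub, ← hpost, ← cocycleAux_zero_add]
      linarith [norm_sub_le (x (n + 1 + k)) (cocycleAux A 0 (n + 1 + k) (Q (x 0))), hx1 k,
        hQ0 (n + 1 + k)]
    refine ⟨Q (x 0) - x 0, hneg, fun k => (hstab k).trans ?_, fun j l hjl => ?_⟩
    · have h1 := pow_nonneg hr0.le k
      have h2 := pow_nonneg hr0.le (n + 1)
      gcongr
      nlinarith
    · rcases l with _ | l
      · obtain rfl : j = n + 1 := by omega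
        have h1 := hstab 0
        change ‖v - cocycleAux A 0 (n + 1) (Q (x 0) - x 0)‖ ≤ _ at h1
        have h2 := norm_sub_norm_le (cocycleAux A 0 (n + 1) (Q (x 0) - x 0)) v
        rw [norm_sub_rev] at h2
        have h3 : r ^ (n + 1) ≤ 1 := pow_le_one₀ hr0.le hr1.le
        have h4 : (K * r ^ 0 + C * K * r ^ (n + 1)) * ‖v‖ ≤ (K + C * K) * ‖v‖ := by
          refine mul_le_mul_of_nonneg_right ?_ hv
          rw [pow_zero, mul_one]
          exact add_le_add le_rfl (mul_le_of_le_one_right hKC h3)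
        rw [pow_zero] at *
        nlinarith
      · rw [map_sub, ← hpre j (by omega)]
        have h3 : r ^ (n + 1) ≤ r ^ (l + 1) :=
          pow_le_pow_of_le_one hr0.le hr1.le (by omega)
        have h4 : C * K * r ^ (n + 1) * ‖v‖ ≤ C * K * r ^ (l + 1) * ‖v‖ := by gcongr
        have h5 := norm_sub_le (cocycleAux A 0 j (Q (x 0))) (x j)
        have h6 : 0 ≤ r ^ (l + 1) * ‖v‖ := by positivity
        nlinarith [hx2 j (l + 1) hjl, hQ0 j]

/-- A sequence that halves after every `T` steps decays geometrically. -/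
lemma le_geometric_of_half_life {a : ℕ → ℝ} {L σ : ℝ} {T : ℕ} (ha : ∀ k, 0 ≤ a k)
    (hT : 0 < T) (hL : 0 ≤ L) (hσ0 : 0 < σ) (hσ1 : σ < 1) (hσ : σ ^ T = 1 / 2)
    (hbound : ∀ k, a k ≤ L * a 0) (hhalf : ∀ k, a (k + T) ≤ 1 / 2 * a k) (k : ℕ) :
    a k ≤ 2 * L * σ ^ k * a 0 := by
  induction k using Nat.strong_induction_on with
  | _ k ih =>
    rcases lt_or_ge k T with h | h
    · have h1 : 1 / 2 ≤ σ ^ k := hσ ▸ pow_le_pow_of_le_one hσ0.le hσ1.le h.le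
      have h2 : 0 ≤ L * a 0 := mul_nonneg hL (ha 0)
      nlinarith [hbound k]
    · obtain ⟨m, rfl⟩ := Nat.exists_eq_add_of_le' h
      have h1 := ih m (by omega)
      rw [pow_add, hσ]
      linarith [hhalf m]

/-- Exponential dichotomy on `ℤ⁺` from estimates indexed by natural numbers. -/
lemma expDichotomy_of_nat {A : ℤ → X →L[ℝ] X} (P : ℕ → X →L[ℝ] X) {K ρ : ℝ} (hK : 0 < K)
    (hρ0 : 0 < ρ) (hρ1 : ρ < 1) (hP : ∀ n v, P n (P n v) = P n v)
    (hinv : ∀ (n : ℕ) v, A n (P n v) = P (n + 1) (A n v))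
    (hbij : ∀ n : ℕ, Set.BijOn (A n) {x : X | P n x = 0} {x : X | P (n + 1) x = 0})
    (hs : ∀ (n k : ℕ) v, ‖cocycleAux A n k (P n v)‖ ≤ K * ρ ^ k * ‖v‖)
    (hu : ∀ (n k : ℕ) x y, P n x = 0 → cocycleAux A n k x = y - P (n + k) y →
      ‖x‖ ≤ K * ρ ^ k * ‖y‖) :
    ExpDichotomy {n : ℤ | 0 ≤ n} {n : ℤ | 0 ≤ n} A := by
  have hexp : ∀ k : ℕ, Real.exp (- -Real.log ρ * k) = ρ ^ k := fun k => by
    rw [neg_neg, mul_comm, Real.exp_nat_mul, Real.exp_log hρ0]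
  refine ⟨fun n => P n.toNat, K, -Real.log ρ, hK, neg_pos.2 (Real.log_neg hρ0 hρ1),
    ?_, ?_, ?_, ?_, ?_⟩
  · intro n _
    ext v
    exact hP _ v
  · intro n hn
    lift n to ℕ using hn
    ext v
    exact hinv n v
  · intro n hn
    lift n to ℕ using hn
    exact hbij n
  · intro m n hm hn hnm
    lift m to ℕ using hm
    lift n to ℕ using hn
    obtain ⟨k, rfl⟩ := Nat.exists_eq_add_of_le (Int.ofNat_le.1 hnm)
    have h1 : (((n + k : ℕ) : ℤ) : ℝ) - ((n : ℤ) : ℝ) = k := by push_cast; ring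
    rw [h1, hexp]
    refine ContinuousLinearMap.opNorm_le_bound _ (by positivity) fun v => ?_
    rw [Nat.cast_add, Phi_add]
    exact hs n k v
  · intro m n hm hn hmn x y hx hxy
    lift m to ℕ using hm
    lift n to ℕ using hn
    obtain ⟨k, rfl⟩ := Nat.exists_eq_add_of_le (Int.ofNat_le.1 hmn)
    have h1 : (((m + k : ℕ) : ℤ) : ℝ) - ((m : ℤ) : ℝ) = k := by push_cast; ring
    rw [h1, hexp]
    refine hu m k x y hx ?_
    rw [Nat.cast_add, Phi_add] at hxy
    exact hxy

theorem expDichotomy_of_impulseResponse [CompleteSpace X] (A : ℤ → X →L[ℝ] X) {K r : ℝ}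
    (hK : 0 < K) (hr0 : 0 < r) (hr1 : r < 1) (hA : HasDecayingImpulseResponse A K r)
    (hS : IsComplementedSubspace (Sset A)) :
    ExpDichotomy {n : ℤ | 0 ≤ n} {n : ℤ | 0 ≤ n} A := by
  obtain ⟨Z, hZ, hdis, hspan⟩ := hS
  rw [← coe_boundedForward_zero] at hdis hspan
  have hc : IsCompl (boundedForward A 0) Z := by
    refine ⟨Submodule.disjoint_def.2 hdis, codisjoint_iff.2 (eq_top_iff.2 fun v _ => ?_)⟩
    obtain ⟨s, hs, z, hz, rfl⟩ := hspan v
    exact Submodule.add_mem_sup hs hz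
  obtain ⟨M, hM, hsplit⟩ := exists_splitting A hK hr0 hr1 hA Z hZ hc
  have hM0 : 0 < M := by linarith
  have hr : ∀ n : ℕ, r ^ n ≤ 1 := fun n => pow_le_one₀ hr0.le hr1.le
  have hrp : ∀ n : ℕ, 0 ≤ r ^ n := fun n => pow_nonneg hr0.le n
  choose z hzZ hst hun using hsplit
  have hmem : ∀ (n : ℕ) v, v - cocycleAux A 0 n (z n v) ∈ boundedForward A n := fun n v => by
    refine mem_boundedForward.2 ⟨M * (1 + 1) * ‖v‖, fun k => (hst n v k).trans ?_⟩
    gcongr <;> apply hr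
  have huniq : ∀ (n : ℕ) v w, w ∈ Z → v - cocycleAux A 0 n w ∈ boundedForward A n →
      z n v = w := fun n v w hw hvw => by
    have h1 : cocycleAux A 0 n (z n v - w) ∈ boundedForward A n := by
      have := (boundedForward A n).sub_mem hvw (hmem n v)
      rwa [sub_sub_sub_cancel_left, ← map_sub] at this
    exact sub_eq_zero.1 (hdis _ ((cocycleAux_zero_mem_boundedForward_iff n).1 h1)
      (Z.sub_mem (hzZ n v) hw))
  have hzadd : ∀ n v w, z n (v + w) = z n v + z n w := fun n v w => by
    refine huniq n _ _ (Z.add_mem (hzZ n v) (hzZ n w)) ?_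
    rw [map_add, add_sub_add_comm]
    exact add_mem (hmem n v) (hmem n w)
  have hzsmul : ∀ n (c : ℝ) v, z n (c • v) = c • z n v := fun n c v => by
    refine huniq n _ _ (Z.smul_mem c (hzZ n v)) ?_
    rw [map_smul, ← smul_sub]
    exact Submodule.smul_mem _ c (hmem n v)
  let P : ℕ → X →L[ℝ] X := fun n => LinearMap.mkContinuous
    { toFun := fun v => v - cocycleAux A 0 n (z n v)
      map_add' := fun v w => by rw [hzadd, map_add, add_sub_add_comm]
      map_smul' := fun c v => by rw [hzsmul, map_smul, ← smul_sub]; rfl }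
    (2 * M) fun v => by
      refine (hst n v 0).trans ?_
      rw [pow_zero]
      refine mul_le_mul_of_nonneg_right ?_ (norm_nonneg v)
      nlinarith [hr n]
  have hPdef : ∀ n v, P n v = v - cocycleAux A 0 n (z n v) := fun n v => rfl
  have hPnorm : ∀ n v, ‖P n v‖ ≤ 2 * M * ‖v‖ := fun n v =>
    (P n).le_of_opNorm_le (LinearMap.mkContinuous_norm_le _ (by positivity) _) v
  have hPmem : ∀ (n : ℕ) v, P n v ∈ boundedForward A n := hmem
  have hzS : ∀ (n : ℕ), ∀ s ∈ boundedForward A n, z n s = 0 := fun n s hs =>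
    huniq n s 0 Z.zero_mem (by simpa using hs)
  have hzZ' : ∀ n, ∀ w ∈ Z, z n (cocycleAux A 0 n w) = w := fun n w hw =>
    huniq n _ w hw (by simp)
  have hPZ : ∀ n, ∀ w ∈ Z, P n (cocycleAux A 0 n w) = 0 := fun n w hw => by
    rw [hPdef, hzZ' n w hw, sub_self]
  have hker : ∀ n x, P n x = 0 → x = cocycleAux A 0 n (z n x) := fun n x hx =>
    sub_eq_zero.1 hx
  have hstep : ∀ (n : ℕ) v, z (n + 1) (A n v) = z n v := fun n v => by
    refine huniq _ _ _ (hzZ n v) ?_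
    rw [cocycleAux_zero_succ, ← map_sub]
    have := (cocycleAux_mem_boundedForward_iff 1).2 (hmem n v)
    simpa [cocycleAux] using this
  have hstable : ∀ (n k : ℕ), ∀ s ∈ boundedForward A n,
      ‖cocycleAux A n k s‖ ≤ M * (r ^ k + r ^ n) * ‖s‖ := fun n k s hs => by
    have := hst n s k
    rwa [hzS n s hs, map_zero, sub_zero] at this
  have hstable' : ∀ (n k : ℕ), ∀ s ∈ boundedForward A n,
      ‖cocycleAux A n k s‖ ≤ 2 * M * ‖s‖ := fun n k s hs => by
    refine (hstable n k s hs).trans ?_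
    refine mul_le_mul_of_nonneg_right ?_ (norm_nonneg s)
    nlinarith [hr n, hr k]
  obtain ⟨N, hN⟩ := exists_pow_lt_of_lt_one (show 0 < 1 / (8 * M ^ 2) by positivity) hr1
  rw [lt_div_iff₀ (by positivity)] at hN
  have hN0 : 0 < N := by
    rcases Nat.eq_zero_or_pos N with rfl | h
    · nlinarith
    · exact h
  have hhalf : ∀ (n : ℕ), ∀ s ∈ boundedForward A n,
      ‖cocycleAux A n (N + N) s‖ ≤ 1 / 2 * ‖s‖ := fun n s hs => by
    have h1 : cocycleAux A n N s ∈ boundedForward A ((n + N : ℕ) : ℤ) := by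
      rw [Nat.cast_add]
      exact (cocycleAux_mem_boundedForward_iff N).2 hs
    rw [cocycleAux_add]
    have h2 := hstable (n + N) N _ h1
    have h3 := hstable' n N s hs
    have h4 : r ^ (n + N) ≤ r ^ N := pow_le_pow_of_le_one hr0.le hr1.le (by omega)
    rw [Nat.cast_add] at h2
    calc _ ≤ M * (r ^ N + r ^ (n + N)) * ‖cocycleAux A n N s‖ := h2
      _ ≤ M * (r ^ N + r ^ N) * (2 * M * ‖s‖) := by
        have := hrp N
        gcongr
      _ = 1 / 2 * (r ^ N * (8 * M ^ 2)) * ‖s‖ := by ring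
      _ ≤ 1 / 2 * 1 * ‖s‖ := by gcongr
      _ = _ := by ring
  obtain ⟨σ, hσ0, hσ1, hσ⟩ : ∃ σ : ℝ, 0 < σ ∧ σ < 1 ∧ σ ^ (N + N) = 1 / 2 := by
    have hT : N + N ≠ 0 := by omega
    refine ⟨(1 / 2 : ℝ) ^ (((N + N : ℕ) : ℝ)⁻¹), by positivity,
      Real.rpow_lt_one (by norm_num) (by norm_num) (by positivity),
      Real.rpow_inv_natCast_pow (by norm_num) hT⟩
  have hdecay : ∀ (n k : ℕ), ∀ s ∈ boundedForward A n,
      ‖cocycleAux A n k s‖ ≤ 2 * (2 * M) * σ ^ k * ‖s‖ := fun n k s hs => by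
    refine le_geometric_of_half_life (a := fun k => ‖cocycleAux A n k s‖)
      (fun _ => norm_nonneg _) (T := N + N) (by omega) (by positivity) hσ0 hσ1 hσ
      (fun k => hstable' n k s hs) (fun k => ?_) k
    have h1 : cocycleAux A n k s ∈ boundedForward A ((n + k : ℕ) : ℤ) := by
      rw [Nat.cast_add]
      exact (cocycleAux_mem_boundedForward_iff k).2 hs
    have h2 := hhalf (n + k) _ h1
    rwa [Nat.cast_add, ← cocycleAux_add] at h2
  refine expDichotomy_of_nat P (K := 8 * M ^ 2) (ρ := max r σ) (by positivity)
    (lt_max_of_lt_left hr0) (max_lt hr1 hσ1) (fun n v => ?_) (fun n v => ?_) (fun n => ?_)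
    (fun n k v => ?_) (fun n k x y hx hxy => ?_)
  · rw [hPdef n (P n v), hzS n _ (hPmem n v), map_zero, sub_zero]
  · rw [hPdef, hPdef, hstep, map_sub, cocycleAux_zero_succ]
  · refine ⟨fun x hx => ?_, fun x hx y hy hxy => ?_, fun x hx => ?_⟩
    · change P (n + 1) (A n x) = 0
      rw [hker n x hx, ← cocycleAux_zero_succ]
      exact hPZ _ _ (hzZ n x)
    · rw [hker n x hx, hker n y hy, ← hstep n x, ← hstep n y, hxy]
    · refine ⟨cocycleAux A 0 n (z (n + 1) x), hPZ _ _ (hzZ _ x), ?_⟩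
      rw [← cocycleAux_zero_succ]
      exact (hker _ x hx).symm
  · calc _ ≤ 2 * (2 * M) * σ ^ k * ‖P n v‖ := hdecay n k _ (hPmem n v)
      _ ≤ 2 * (2 * M) * max r σ ^ k * (2 * M * ‖v‖) := by
        gcongr
        · exact le_max_right _ _
        · exact hPnorm n v
      _ = _ := by ring
  · have h1 : z n x = z (n + k) y := by
      rw [hPdef, sub_sub_cancel] at hxy
      rw [hker n x hx, ← cocycleAux_zero_add] at hxy
      rw [← hzZ' (n + k) _ (hzZ n x), hxy, hzZ' _ _ (hzZ _ y)]
    rw [hker n x hx, h1]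
    refine (hun (n + k) y n k rfl).trans ?_
    have h2 : M ≤ 8 * M ^ 2 := by nlinarith
    gcongr
    exact le_max_left _ _

lemma exists_ker_preimage {J : Set ℤ} {A P : ℤ → X →L[ℝ] X}
    (hJ : ∀ n : ℕ, (n : ℤ) ∈ J)
    (hbij : ∀ n ∈ J, Set.BijOn (A n) {x : X | P n x = 0} {x : X | P (n + 1) x = 0})
    (n : ℕ) (w : X) (hw : P n w = 0) :
    ∃ u, cocycleAux A 0 n u = w ∧ ∀ j ≤ n, P j (cocycleAux A 0 j u) = 0 := by
  induction n generalizing w with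
  | zero =>
    refine ⟨w, rfl, fun j hj => ?_⟩
    obtain rfl : j = 0 := by omega
    exact hw
  | succ n ih =>
    obtain ⟨w', hw', rfl⟩ := (hbij n (hJ n)).surjOn (by push_cast at hw; exact hw)
    obtain ⟨u, rfl, hu⟩ := ih w' hw'
    refine ⟨u, cocycleAux_zero_succ A n u, fun j hj => ?_⟩
    rcases Nat.lt_or_ge n j with h | h
    · obtain rfl : j = n + 1 := by omega
      rw [cocycleAux_zero_succ]
      exact hw
    · exact hu j h

lemma hasDecayingImpulseResponse_of_triangular (A11 : ℤ → X1 →L[ℝ] X1)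
    (A12 : ℤ → X2 →L[ℝ] X1) (A22 : ℤ → X2 →L[ℝ] X2)
    (htri : ExpDichotomy {n : ℤ | 0 ≤ n} {n : ℤ | 0 ≤ n} (triangular A11 A12 A22)) :
    ∃ K r : ℝ, 0 < K ∧ 0 < r ∧ r < 1 ∧ HasDecayingImpulseResponse A22 K r := by
  obtain ⟨P, K, α, hK, hα, hP, -, hbij, hs, hu⟩ := htri
  set A := triangular A11 A12 A22 with hAdef
  have hsnd : ∀ (n : ℤ) y, (A n y).2 = A22 n y.2 := fun n y => rfl
  have hexp : ∀ k : ℕ, Real.exp (-α * k) = Real.exp (-α) ^ k := fun k => by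
    rw [mul_comm, Real.exp_nat_mul]
  have hcast : ∀ n k : ℕ, (((n + k : ℕ) : ℤ) : ℝ) - ((n : ℤ) : ℝ) = k := fun n k => by
    push_cast; ring
  refine ⟨K, Real.exp (-α), hK, Real.exp_pos _, by simpa using hα,
    fun n v => ?_⟩
  have hs' : ∀ (n k : ℕ) y,
      ‖cocycleAux A n k (P n y)‖ ≤ K * Real.exp (-α) ^ k * ‖y‖ := fun n k y => by
    have h1 := hs (n + k : ℕ) n (Int.natCast_nonneg _) (Int.natCast_nonneg _)
      (by push_cast; omega)
    rw [hcast, hexp, Nat.cast_add, Phi_add] at h1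
    exact ContinuousLinearMap.le_of_opNorm_le _ h1 y
  have hu' : ∀ (n k : ℕ) x y, P n x = 0 →
      cocycleAux A n k x = y - P ((n + k : ℕ) : ℤ) y →
      ‖x‖ ≤ K * Real.exp (-α) ^ k * ‖y‖ := fun n k x y hx hxy => by
    have h1 := hu n (n + k : ℕ) (Int.natCast_nonneg _) (Int.natCast_nonneg _)
      (by push_cast; omega) x y hx (by rw [← hxy, Nat.cast_add, Phi_add])
    rwa [hcast, hexp] at h1
  set w : X1 × X2 := (0, v) with hwdef
  have hw : ‖w‖ = ‖v‖ := by simp [hwdef, Prod.norm_def]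
  have hPw : P ((n + 1 : ℕ) : ℤ) (w - P ((n + 1 : ℕ) : ℤ) w) = 0 := by
    rw [map_sub, sub_eq_zero]
    exact (DFunLike.congr_fun (hP _ (Int.natCast_nonneg _)) w).symm
  obtain ⟨u, huw, huP⟩ := exists_ker_preimage (J := {n : ℤ | 0 ≤ n}) Int.natCast_nonneg hbij (n + 1) _ hPw
  let x : ℕ → X2 := fun m => if m ≤ n then -(cocycleAux A 0 m u).2
    else (cocycleAux A ((n + 1 : ℕ) : ℤ) (m - (n + 1)) (P ((n + 1 : ℕ) : ℤ) w)).2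
  have hxl : ∀ m ≤ n, x m = -(cocycleAux A 0 m u).2 := fun m hm => if_pos hm
  have hxr : ∀ k, x (n + 1 + k)
      = (cocycleAux A ((n + 1 : ℕ) : ℤ) k (P ((n + 1 : ℕ) : ℤ) w)).2 := fun k => by
    simp only [x]
    rw [if_neg (by omega), Nat.add_sub_cancel_left]
  have hright : ∀ k : ℕ, ‖x (n + 1 + k)‖ ≤ K * Real.exp (-α) ^ k * ‖v‖ := fun k => by
    rw [hxr, ← hw]
    exact (_root_.norm_snd_le _).trans (hs' (n + 1) k w)
  refine ⟨x, fun m => ?_, hright, fun j l hjl => ?_⟩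
  · rcases lt_trichotomy m n with h | rfl | h
    · rw [hxl m h.le, hxl (m + 1) h, if_neg h.ne, add_zero, cocycleAux_zero_succ, hsnd, map_neg]
    · have h1 : (cocycleAux A 0 (m + 1) u).2 = v - (P ((m + 1 : ℕ) : ℤ) w).2 := by
        rw [huw]; rfl
      rw [cocycleAux_zero_succ, hsnd] at h1
      rw [hxl m le_rfl, if_pos rfl, map_neg, h1]
      refine (hxr 0).trans ?_
      simp [cocycleAux]
    · obtain ⟨k, rfl⟩ := Nat.exists_eq_add_of_le (Nat.succ_le_of_lt h)
      rw [Nat.succ_eq_add_one, add_assoc, hxr (k + 1), hxr k, if_neg (by omega), add_zero,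
        cocycleAux_succ_apply, hsnd]
      push_cast
      rfl
  · rcases l with _ | l
    · obtain rfl : j = n + 1 := by omega
      exact hright 0
    · rw [hxl j (by omega), norm_neg, ← hw]
      refine (_root_.norm_snd_le _).trans (hu' j (l + 1) _ w (huP j (by omega)) ?_)
      rw [← cocycleAux_zero_add, hjl]
      exact huw

theorem block2_dichotomy_of_triangular_Zplus {H1 : Type u} {H2 : Type u}
    [NormedAddCommGroup H1] [InnerProductSpace ℝ H1] [CompleteSpace H1]
    [NormedAddCommGroup H2] [InnerProductSpace ℝ H2] [CompleteSpace H2]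
    (A11 : ℤ → H1 →L[ℝ] H1) (A12 : ℤ → H2 →L[ℝ] H1) (A22 : ℤ → H2 →L[ℝ] H2)
    (htri : ExpDichotomy {n : ℤ | 0 ≤ n} {n : ℤ | 0 ≤ n} (triangular A11 A12 A22))
    (hS2 : IsComplementedSubspace (Sset A22)) :
    ExpDichotomy {n : ℤ | 0 ≤ n} {n : ℤ | 0 ≤ n} A22 := by
  obtain ⟨K, r, hK, hr0, hr1, h⟩ := hasDecayingImpulseResponse_of_triangular A11 A12 A22 htri
  exact expDichotomy_of_impulseResponse A22 hK hr0 hr1 h hS2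

end
end
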